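/- Let Q = Q(n,t_1,…,t_n) be the linear quiver with vertices 0,1,…,n, one loop ε_i at each vertex i, and for each 1 ≤ i ≤ n arrows α_{1i},…,α_{t_i i} from vertex i to vertex i−1 (with n ≥ 1 and all t_i ≥ 1), and let A = KQ/I with I an admissible ideal. Grade KQ by deg(ε_i) = 0 and deg(α_{ji}) = 1, and let R = R_0 ∪ R_1 ∪ ⋯ ∪ R_n be a minimal set of relations generating I decomposed by degree (R_i the relations of degree i in R for i ≥ 1). If A is geometrically irreducible, then R_2 = R_3 = ⋯ = R_n = ∅, i.e. I is generated by relations of degree at most one. -/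

import Mathlib

open scoped BigOperators

noncomputable section
/-! ## Quivers and paths -/

/-- A finite quiver: finite sets of vertices and arrows together with source and
target maps. -/
structure FinQuiver : Type 1 where
  V : Type
  A : Type
  [fintypeV : Fintype V]
  [fintypeA : Fintype A]
  [decEqV : DecidableEq V]
  [decEqA : DecidableEq A]
  src : A → V
  tgt : A → V

attribute [instance] FinQuiver.fintypeV FinQuiver.fintypeA FinQuiver.decEqV FinQuiver.decEqA

/-- A path of positive length in a quiver: a list of composable arrows `[a₁, …, aₘ]`
satisfying `s (aᵢ) = t (aᵢ₊₁)`. -/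
structure QPath (Q : FinQuiver) : Type where
  arrows : List Q.A
  ne : arrows ≠ []
  chain : arrows.Chain' fun a b => Q.src a = Q.tgt b

namespace QPath

variable {Q : FinQuiver}

/-- The length of a path. -/
def length (p : QPath Q) : ℕ := p.arrows.length

/-- The target `t (a₁)` of a path `(a₁, …, aₘ)`. -/
def tgt (p : QPath Q) : Q.V := Q.tgt (p.arrows.head p.ne)

/-- The source `s (aₘ)` of a path `(a₁, …, aₘ)`. -/
def src (p : QPath Q) : Q.V := Q.src (p.arrows.getLast p.ne)

/-- A path is a cycle if its source equals its target. -/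
def IsCycle (p : QPath Q) : Prop := p.src = p.tgt

/-- A cycle `(a₁, …, aₘ)` is primitive if the vertices `s (a₁), …, s (aₘ)` are pairwise
different. -/
def IsPrimitive (p : QPath Q) : Prop := (p.arrows.map Q.src).Nodup

end QPath

/-! ## The path algebra, relations, admissible ideals and representation varieties -/

/-- The defining relations presenting the path algebra `KQ` as a quotient of the free
algebra on the vertices and arrows of `Q`: the vertices become a complete set of
orthogonal idempotents summing to `1`, and `e_{t(a)} * a = a = a * e_{s(a)}` for every
arrow `a`. -/
inductive PathRel (K : Type) [Field K] (Q : FinQuiver) :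
    FreeAlgebra K (Q.V ⊕ Q.A) → FreeAlgebra K (Q.V ⊕ Q.A) → Prop
  | idem (i : Q.V) : PathRel K Q
      (FreeAlgebra.ι K (Sum.inl i) * FreeAlgebra.ι K (Sum.inl i)) (FreeAlgebra.ι K (Sum.inl i))
  | orth (i j : Q.V) (h : i ≠ j) : PathRel K Q
      (FreeAlgebra.ι K (Sum.inl i) * FreeAlgebra.ι K (Sum.inl j)) 0
  | sum_one : PathRel K Q (∑ i : Q.V, FreeAlgebra.ι K (Sum.inl i)) 1
  | tgt_mul (a : Q.A) : PathRel K Q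
      (FreeAlgebra.ι K (Sum.inl (Q.tgt a)) * FreeAlgebra.ι K (Sum.inr a))
      (FreeAlgebra.ι K (Sum.inr a))
  | mul_src (a : Q.A) : PathRel K Q
      (FreeAlgebra.ι K (Sum.inr a) * FreeAlgebra.ι K (Sum.inl (Q.src a)))
      (FreeAlgebra.ι K (Sum.inr a))

/-- The path algebra `KQ`. -/
abbrev PathAlgebra (K : Type) [Field K] (Q : FinQuiver) : Type := RingQuot (PathRel K Q)

variable (K : Type) [Field K] (Q : FinQuiver)

/-- The idempotent `eᵢ ∈ KQ` corresponding to a vertex `i` (the path of length zero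
at `i`). -/
def vertexElem (i : Q.V) : PathAlgebra K Q :=
  RingQuot.mkAlgHom K (PathRel K Q) (FreeAlgebra.ι K (Sum.inl i))

/-- The element of `KQ` corresponding to an arrow `a`. -/
def arrowElem (a : Q.A) : PathAlgebra K Q :=
  RingQuot.mkAlgHom K (PathRel K Q) (FreeAlgebra.ι K (Sum.inr a))

/-- The element of `KQ` corresponding to a path `(a₁, …, aₘ)`, namely `a₁ ⋯ aₘ`. -/
def pathElem (p : QPath Q) : PathAlgebra K Q := (p.arrows.map (arrowElem K Q)).prod

/-- The element `∑ₚ c p • p` of `KQ` determined by a finitely supported family of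
coefficients on paths. -/
def relElem (c : QPath Q →₀ K) : PathAlgebra K Q := c.sum fun p l => l • pathElem K Q p

/-- `c` is the datum of a relation with common target `i` and common source `j`: all
paths in its support have length at least two, target `i` and source `j`.  (The paths in
the support are pairwise different and have nonzero coefficients by definition of a
finitely supported function.) -/
def IsRelationData (c : QPath Q →₀ K) (i j : Q.V) : Prop :=
  ∀ p ∈ c.support, 2 ≤ p.length ∧ p.tgt = i ∧ p.src = j

/-- An element of `KQ` is a relation if it is a `K`-linear combination `∑ λₚ • p` of
pairwise different paths of length at least two having a common source and a common
target, with all `λₚ ≠ 0`. -/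
def IsRelation (x : PathAlgebra K Q) : Prop :=
  ∃ (c : QPath Q →₀ K) (i j : Q.V), IsRelationData K Q c i j ∧ x = relElem K Q c

/-- The two-sided ideal generated by a set `S`, as a set: the additive subgroup generated
by all elements `a * s * b` with `s ∈ S`. -/
def twoSidedSpan (R : Type) [Ring R] (S : Set R) : Set R :=
  (AddSubgroup.closure {x | ∃ a b : R, ∃ s ∈ S, x = a * s * b} : AddSubgroup R)

/-- `φ : KQ →ₐ[K] A` presents `A` as `KQ/I` with `I = ker φ` an admissible ideal:
`φ` is surjective, its kernel is generated (as a two-sided ideal) by a set of relations,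
and there is some `m ≥ 2` such that all paths of length at least `m` lie in the kernel. -/
def IsAdmissiblePresentation {A : Type} [Ring A] [Algebra K A]
    (φ : PathAlgebra K Q →ₐ[K] A) : Prop :=
  Function.Surjective φ ∧
  (∃ S : Set (PathAlgebra K Q), (∀ x ∈ S, IsRelation K Q x) ∧
    twoSidedSpan (PathAlgebra K Q) S = {x | φ x = 0}) ∧
  ∃ m : ℕ, 2 ≤ m ∧ ∀ p : QPath Q, m ≤ p.length → φ (pathElem K Q p) = 0

/-- The index type for the rows/columns of the matrices in a `d`-dimensional
representation: the basis vectors of `⊕ᵢ K^{dᵢ}`. -/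
abbrev RepIx (d : Q.V → ℕ) : Type := (i : Q.V) × Fin (d i)

/-- The ambient affine space of `d`-dimensional representations.  An arrow `a` gets a
matrix; membership in `RepSet` forces the matrix of `a` to be concentrated in the block
with rows indexed by the block `t(a)` and columns indexed by the block `s(a)`, i.e. to be
(the block extension of) a `d (t a) × d (s a)`-matrix. -/
abbrev RepSpace (d : Q.V → ℕ) : Type := Q.A → Matrix (RepIx Q d) (RepIx Q d) K

/-- The Zariski topology on affine space `K^ι`: generated by the complements of zero sets
of polynomials in the coordinates. -/
def zariskiTopology (ι R : Type) [CommSemiring R] : TopologicalSpace (ι → R) :=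
  TopologicalSpace.generateFrom
    {U | ∃ f : MvPolynomial ι R, U = {x | MvPolynomial.eval x f ≠ 0}}

/-- The Zariski topology on the ambient space of `d`-dimensional representations. -/
def repTopology (d : Q.V → ℕ) : TopologicalSpace (RepSpace K Q d) :=
  TopologicalSpace.induced (fun M (x : Q.A × RepIx Q d × RepIx Q d) => M x.1 x.2.1 x.2.2)
    (zariskiTopology (Q.A × RepIx Q d × RepIx Q d) K)

/-- The condition that the matrix of each arrow `a` is concentrated in the
`(t a, s a)`-block, i.e. really is a `d (t a) × d (s a)`-matrix. -/
def BlockCompatible (d : Q.V → ℕ) (M : RepSpace K Q d) : Prop :=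
  ∀ (a : Q.A) (u v : RepIx Q d), M a u v ≠ 0 → u.1 = Q.tgt a ∧ v.1 = Q.src a

/-- The evaluation `M(p) = M(a₁) ⋯ M(aₘ)` of a representation at a path. -/
def pathProd (d : Q.V → ℕ) (M : RepSpace K Q d) (p : QPath Q) :
    Matrix (RepIx Q d) (RepIx Q d) K := (p.arrows.map M).prod

/-- The evaluation `M(ρ) = ∑ λₚ M(p)` of a representation at a linear combination of
paths. -/
def relEval (d : Q.V → ℕ) (M : RepSpace K Q d) (c : QPath Q →₀ K) :
    Matrix (RepIx Q d) (RepIx Q d) K := c.sum fun p l => l • pathProd K Q d M p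

/-- The affine variety `rep(A, d)` of `d`-dimensional representations of `A = KQ/I`,
where `I = ker φ`: tuples of matrices (of the correct block sizes) with `M(ρ) = 0` for
every relation `ρ ∈ I`. -/
def RepSet {A : Type} [Ring A] [Algebra K A] (φ : PathAlgebra K Q →ₐ[K] A) (d : Q.V → ℕ) :
    Set (RepSpace K Q d) :=
  {M | BlockCompatible K Q d M ∧
    ∀ (c : QPath Q →₀ K) (i j : Q.V), IsRelationData K Q c i j →
      φ (relElem K Q c) = 0 → relEval K Q d M c = 0}

/-- `A = KQ/I` (presented by `φ`, with `I = ker φ`) is geometrically irreducible if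
`rep(A, d)` is an irreducible topological space for every dimension vector `d`. -/
def IsGeomIrreducible {A : Type} [Ring A] [Algebra K A] (φ : PathAlgebra K Q →ₐ[K] A) :
    Prop :=
  ∀ d : Q.V → ℕ, @IsIrreducible _ (repTopology K Q d) (RepSet K Q φ d)

/-! ## The linear quivers `Q(n, t₁, …, tₙ)` and the degree grading -/

/-- The linear quiver `Q(n, t₁, …, tₙ)`: vertices `0, 1, …, n`, one loop `εᵢ` at each
vertex `i` (the arrows `Sum.inl i`), and for each `1 ≤ i ≤ n` the arrows
`α_{1i}, …, α_{tᵢi}` from vertex `i` to vertex `i - 1` (the arrows `Sum.inr ⟨i-1, j⟩`). -/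
def LinearQuiver (n : ℕ) (t : Fin n → ℕ) : FinQuiver where
  V := Fin (n + 1)
  A := Fin (n + 1) ⊕ ((i : Fin n) × Fin (t i))
  src := Sum.elim id fun x => x.1.succ
  tgt := Sum.elim id fun x => x.1.castSucc

/-- The degree of a path in the linear quiver, for the grading with `deg εᵢ = 0` and
`deg α_{ji} = 1`: the number of non-loop arrows occurring in the path. -/
def pathDegree {n : ℕ} {t : Fin n → ℕ} (p : QPath (LinearQuiver n t)) : ℕ :=
  p.arrows.countP fun a => a.isRight

/-- A relation for the linear quiver all of whose paths have degree at most one. -/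
def IsDegreeLeOneRelation {n : ℕ} {t : Fin n → ℕ} (x : PathAlgebra K (LinearQuiver n t)) :
    Prop :=
  ∃ (c : QPath (LinearQuiver n t) →₀ K) (i j : Fin (n + 1)),
    IsRelationData K (LinearQuiver n t) c i j ∧ (∀ p ∈ c.support, pathDegree p ≤ 1) ∧
    x = relElem K (LinearQuiver n t) c

/-- A relation for the linear quiver all of whose paths have degree exactly one. -/
def IsDegreeOneRelation {n : ℕ} {t : Fin n → ℕ} (x : PathAlgebra K (LinearQuiver n t)) :
    Prop :=
  ∃ (c : QPath (LinearQuiver n t) →₀ K) (i j : Fin (n + 1)),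
    IsRelationData K (LinearQuiver n t) c i j ∧ (∀ p ∈ c.support, pathDegree p = 1) ∧
    x = relElem K (LinearQuiver n t) c

section TriangularAlgebra

open scoped TensorProduct

variable {K} {A : Type} [Ring A] [Algebra K A] {ι : Type}

/-- The representations of `A` on `X` for which each `e v` acts as the prescribed
endomorphism `P v`. -/
def RepsWith (e : ι → A) (X : Type) [AddCommGroup X] [Module K X]
    (P : ι → Module.End K X) : Type :=
  {Ψ : A →ₐ[K] Module.End K X // ∀ v, Ψ (e v) = P v}

/-- The algebra of functions on `RepsWith e X P` generated by the matrix coefficients. -/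
def coeffAlgebra (e : ι → A) (X : Type) [AddCommGroup X] [Module K X]
    (P : ι → Module.End K X) : Subalgebra K (RepsWith e X P → K) :=
  Algebra.adjoin K {F | ∃ (a : A) (l : Module.Dual K X) (x : X), F = fun Ψ => l (Ψ.1 a x)}

lemma coeff_mem (e : ι → A) (X : Type) [AddCommGroup X] [Module K X]
    (P : ι → Module.End K X) (a : A) (l : Module.Dual K X) (x : X) :
    (fun Ψ : RepsWith e X P => l (Ψ.1 a x)) ∈ coeffAlgebra e X P :=
  Algebra.subset_adjoin ⟨a, l, x, rfl⟩

/-- Linear independence of finitely many vectors depending regularly on a parameter is an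
open condition. -/
lemma exists_mem_ne_zero_linearIndependent {Ω W κ : Type} [AddCommGroup W] [Module K W]
    [Fintype κ] (B : Subalgebra K (Ω → K)) (v : κ → Ω → W)
    (hv : ∀ (k : κ) (l : Module.Dual K W), (fun ω => l (v k ω)) ∈ B) (ω₀ : Ω)
    (h0 : LinearIndependent K fun k => v k ω₀) :
    ∃ F ∈ B, F ω₀ ≠ 0 ∧ ∀ ω, F ω ≠ 0 → LinearIndependent K fun k => v k ω := by
  classical
  obtain ⟨g, hg⟩ := LinearMap.exists_leftInverse_of_injective
    (Finsupp.linearCombination K fun k => v k ω₀) (LinearMap.ker_eq_bot.2 h0)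
  let l : κ → Module.Dual K W := fun k => (Finsupp.lapply k).comp g
  have hl : ∀ k m, l k (v m ω₀) = if k = m then 1 else 0 := by
    intro k m
    have h := DFunLike.congr_fun hg (Finsupp.single m (1 : K))
    simp only [LinearMap.comp_apply, Finsupp.linearCombination_single, one_smul,
      LinearMap.id_apply] at h
    simp [l, h, Finsupp.single_apply, eq_comm]
  refine ⟨fun ω => (Matrix.of fun k m => l k (v m ω)).det, ?_, ?_, ?_⟩
  · have : (fun ω => (Matrix.of fun k m => l k (v m ω)).det) =
        ∑ σ : Equiv.Perm κ, (Equiv.Perm.sign σ : ℤ) •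
          ∏ k, (fun ω => l (σ k) (v k ω)) := by
      funext ω
      simp [Matrix.det_apply, Finset.sum_apply, Finset.prod_apply, Units.smul_def]
    rw [this]
    exact sum_mem fun σ _ => zsmul_mem (prod_mem fun k _ => hv k _) _
  · have : (Matrix.of fun k m => l k (v m ω₀)) = 1 := by
      ext k m
      simp [hl, Matrix.one_apply]
    simp [this]
  · intro ω hω
    rw [Fintype.linearIndependent_iff]
    intro c hc
    refine congrFun (Matrix.eq_zero_of_mulVec_eq_zero hω (v := c) ?_)
    funext k
    have := congrArg (l k) hc
    simpa [Matrix.mulVec, dotProduct, map_sum, mul_comm] using this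

/-- The subspace of `A ⊗ A` whose quotient is `p A q ⊗ A` tensored over `q A q`. -/
def cornerRel (p q : A) : Submodule K (A ⊗[K] A) :=
  Submodule.span K
    ({w | ∃ b a : A, w = b ⊗ₜ a - (p * b * q) ⊗ₜ a} ∪
      {w | ∃ b g a : A, w = (b * (q * g * q)) ⊗ₜ a - b ⊗ₜ (q * g * q * a)})

/-- The corner tensor product `p A q ⊗ A` over `q A q`. -/
abbrev CornerTensor (p q : A) : Type := (A ⊗[K] A) ⧸ (cornerRel p q : Submodule K (A ⊗[K] A))

/-- The class of `b ⊗ a` in the corner tensor product. -/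
def cornerMk (K : Type) [Field K] {A : Type} [Ring A] [Algebra K A] (p q b a : A) :
    CornerTensor (K := K) p q :=
  (cornerRel p q).mkQ (b ⊗ₜ a)

lemma cornerMk_compress (p q b a : A) :
    cornerMk K p q (p * b * q) a = cornerMk K p q b a :=
  Eq.symm <| (Submodule.Quotient.eq (cornerRel p q)).2 <|
    Submodule.subset_span (Or.inl ⟨b, a, rfl⟩)

lemma cornerMk_balanced (p q b g a : A) :
    cornerMk K p q (b * (q * g * q)) a = cornerMk K p q b (q * g * q * a) :=
  (Submodule.Quotient.eq (cornerRel p q)).2 <|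
    Submodule.subset_span (Or.inr ⟨b, g, a, rfl⟩)

lemma cornerMk_add_left (p q b b' a : A) :
    cornerMk K p q (b + b') a = cornerMk K p q b a + cornerMk K p q b' a := by
  simp [cornerMk, TensorProduct.add_tmul]

lemma cornerMk_smul_left (p q b a : A) (r : K) :
    cornerMk K p q (r • b) a = r • cornerMk K p q b a := by
  simp [cornerMk, ← TensorProduct.smul_tmul']

lemma cornerMk_zero_left (p q a : A) : cornerMk K p q 0 a = 0 := by
  simp [cornerMk]

lemma cornerMk_zero_right (p q b : A) : cornerMk K p q b 0 = 0 := by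
  simp [cornerMk]

@[elab_as_elim]
lemma corner_induction {p q : A} {C : CornerTensor (K := K) p q → Prop}
    (y : CornerTensor (K := K) p q) (mk : ∀ b a, C (cornerMk K p q b a))
    (add : ∀ y z, C y → C z → C (y + z)) : C y := by
  obtain ⟨w, rfl⟩ := Submodule.mkQ_surjective _ y
  induction w with
  | zero => simpa [cornerMk] using mk 0 0
  | tmul b a => exact mk b a
  | add w z hw hz => rw [map_add]; exact add _ _ hw hz

/-- The action of `p A p` on the corner tensor product. -/
def cornerAct {p : A} (hp : p * p = p) (q c : A) :
    CornerTensor (K := K) p q →ₗ[K] CornerTensor (K := K) p q :=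
  (cornerRel p q).mapQ (cornerRel p q) (LinearMap.rTensor A (LinearMap.mulLeft K (p * c * p)))
    (by
      rw [cornerRel, Submodule.span_le]
      rintro _ (⟨b, a, rfl⟩ | ⟨b, g, a, rfl⟩) <;> refine Submodule.subset_span ?_
      · refine Or.inl ⟨p * c * p * b, a, ?_⟩
        have h : p * (p * c * p * b) * q = p * c * p * (p * b * q) := by
          simp only [mul_assoc, hp, ← mul_assoc p p]
        simp only [map_sub, LinearMap.rTensor_tmul,
          LinearMap.mulLeft_apply, h]
      · refine Or.inr ⟨p * c * p * b, g, a, ?_⟩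
        simp only [map_sub, LinearMap.rTensor_tmul, LinearMap.mulLeft_apply, mul_assoc])

lemma cornerAct_mk {p : A} (hp : p * p = p) (q c b a : A) :
    cornerAct (K := K) hp q c (cornerMk K p q b a) = cornerMk K p q (p * c * p * b) a := by
  rw [cornerAct, cornerMk, Submodule.mkQ_apply, Submodule.mapQ_apply, LinearMap.rTensor_tmul,
    LinearMap.mulLeft_apply]
  rfl

section Triangular

variable [Fintype ι] {e : ι → A}

lemma sum_mul_idempotent_mul (he : CompleteOrthogonalIdempotents e) (a b : A) :
    ∑ u, a * e u * b = a * b := by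
  rw [← Finset.sum_mul, ← Finset.mul_sum, he.complete, mul_one]

variable [LinearOrder ι]

lemma corner_mul (he : CompleteOrthogonalIdempotents e)
    (ht : ∀ u v, u < v → ∀ a, e v * a * e u = 0) (v : ι) (a b : A) :
    e v * (a * b) * e v = e v * a * e v * (e v * b * e v) := by
  rw [← sum_mul_idempotent_mul he a b, Finset.mul_sum, Finset.sum_mul,
    Finset.sum_eq_single v _ (by simp)]
  · simp only [← mul_assoc]
    simp only [mul_assoc _ (e v) (e v), (he.idem v).eq]
  · intro u _ hu
    rcases lt_or_gt_of_ne hu with h | h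
    · rw [← mul_assoc, ← mul_assoc, ht u v h, zero_mul, zero_mul]
    · have := ht v u h b
      simp only [mul_assoc] at this ⊢
      simp [this]

lemma corner_mul_of_covBy (he : CompleteOrthogonalIdempotents e)
    (ht : ∀ u v, u < v → ∀ a, e v * a * e u = 0) {i j : ι} (hij : i ⋖ j) (a b : A) :
    e i * (a * b) * e j =
      e i * a * e i * (e i * b * e j) + e i * a * e j * (e j * b * e j) := by
  rw [← sum_mul_idempotent_mul he a b, Finset.mul_sum, Finset.sum_mul,
    Finset.sum_eq_add i j hij.ne _ (by simp) (by simp)]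
  · simp only [← mul_assoc]
    simp only [mul_assoc _ (e i) (e i), mul_assoc _ (e j) (e j), (he.idem i).eq, (he.idem j).eq]
  · intro u _ hu
    rcases lt_or_gt_of_ne hu.1 with h | h
    · rw [← mul_assoc, ← mul_assoc, ht u i h, zero_mul, zero_mul]
    · have hju : j < u := lt_of_le_of_ne (not_lt.1 fun h' => hij.2 h h') hu.2.symm
      have := ht j u hju b
      simp only [mul_assoc] at this ⊢
      simp [this]

/-- The projection of a triangular algebra onto its diagonal part. -/
def diagHom (he : CompleteOrthogonalIdempotents e)
    (ht : ∀ u v, u < v → ∀ a, e v * a * e u = 0) : A →ₐ[K] A :=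
  AlgHom.ofLinearMap
    (∑ v, (LinearMap.mulLeft K (e v)).comp (LinearMap.mulRight K (e v)))
    (by simp [(he.idem _).eq, he.complete])
    (by
      intro a b
      simp only [LinearMap.sum_apply, LinearMap.comp_apply, LinearMap.mulLeft_apply,
        LinearMap.mulRight_apply, ← mul_assoc, Finset.sum_mul, Finset.mul_sum]
      refine Finset.sum_congr rfl fun v _ => ?_
      rw [Finset.sum_eq_single v _ (by simp)]
      · simpa only [← mul_assoc] using corner_mul he ht v a b
      · intro u _ hu
        simp only [mul_assoc _ (e u) (e v), he.ortho hu, mul_zero, zero_mul])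

lemma diagHom_apply (he : CompleteOrthogonalIdempotents e)
    (ht : ∀ u v, u < v → ∀ a, e v * a * e u = 0) (a : A) :
    diagHom (K := K) he ht a = ∑ v, e v * a * e v := by
  simp [diagHom, mul_assoc]

lemma mul_diagHom (he : CompleteOrthogonalIdempotents e)
    (ht : ∀ u v, u < v → ∀ a, e v * a * e u = 0) (v : ι) (a : A) :
    e v * diagHom (K := K) he ht a = e v * a * e v := by
  rw [diagHom_apply, Finset.mul_sum, Finset.sum_eq_single v _ (by simp)]
  · simp only [← mul_assoc, (he.idem v).eq]
  · intro u _ hu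
    simp only [← mul_assoc, he.ortho hu.symm, zero_mul]

lemma diagHom_corner (he : CompleteOrthogonalIdempotents e)
    (ht : ∀ u v, u < v → ∀ a, e v * a * e u = 0) (v : ι) (a : A) :
    diagHom (K := K) he ht (e v * a * e v) = e v * a * e v := by
  rw [diagHom_apply, Finset.sum_eq_single v _ (by simp)]
  · simp only [← mul_assoc, (he.idem v).eq]
    simp only [mul_assoc, (he.idem v).eq]
  · intro u _ hu
    simp only [← mul_assoc, he.ortho hu, zero_mul]

lemma diagHom_idempotent (he : CompleteOrthogonalIdempotents e)
    (ht : ∀ u v, u < v → ∀ a, e v * a * e u = 0) (v : ι) :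
    diagHom (K := K) he ht (e v) = e v := by
  have := diagHom_corner (K := K) he ht v 1
  simpa [(he.idem v).eq] using this

lemma diagHom_off_diagonal (he : CompleteOrthogonalIdempotents e)
    (ht : ∀ u v, u < v → ∀ a, e v * a * e u = 0) {i j : ι} (hij : i ≠ j) (a : A) :
    diagHom (K := K) he ht (e i * a * e j) = 0 := by
  rw [diagHom_apply]
  refine Finset.sum_eq_zero fun u _ => ?_
  by_cases h : u = i
  · subst h; simp only [mul_assoc, he.ortho hij.symm, mul_zero]
  · simp only [← mul_assoc, he.ortho h, zero_mul]

/-- The corner tensor product as a representation concentrated at the vertex `i`. -/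
def cornerHom (he : CompleteOrthogonalIdempotents e)
    (ht : ∀ u v, u < v → ∀ a, e v * a * e u = 0) (i j : ι) :
    A →ₐ[K] Module.End K (CornerTensor (K := K) (e i) (e j)) :=
  AlgHom.ofLinearMap
    { toFun := cornerAct (he.idem i).eq (e j)
      map_add' := fun c d => by
        refine LinearMap.ext fun y => ?_
        induction y using corner_induction with
        | mk b a => simp [cornerAct_mk, mul_add, add_mul, cornerMk_add_left]
        | add y z hy hz => simp only [map_add, hy, hz]
      map_smul' := fun r c => by
        refine LinearMap.ext fun y => ?_
        induction y using corner_induction with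
        | mk b a => simp [cornerAct_mk, cornerMk_smul_left]
        | add y z hy hz => simp only [map_add, hy, hz] }
    (by
      refine LinearMap.ext fun y => ?_
      induction y using corner_induction with
      | mk b a =>
        change cornerAct (he.idem i).eq (e j) _ _ = _
        rw [cornerAct_mk, ← cornerMk_compress, ← cornerMk_compress _ _ b]
        simp only [mul_one, ← mul_assoc, (he.idem i).eq, Module.End.one_apply]
      | add y z hy hz => simp only [map_add, hy, hz])
    (by
      intro c d
      refine LinearMap.ext fun y => ?_
      induction y using corner_induction with
      | mk b a =>
        change cornerAct (he.idem i).eq (e j) (c * d) (cornerMk K (e i) (e j) b a) =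
          cornerAct (he.idem i).eq (e j) c
            (cornerAct (he.idem i).eq (e j) d (cornerMk K (e i) (e j) b a))
        rw [cornerAct_mk (K := K), cornerAct_mk (K := K), cornerAct_mk (K := K), corner_mul he ht,
          mul_assoc]
      | add y z hy hz => simp only [map_add, hy, hz])

lemma cornerHom_mk (he : CompleteOrthogonalIdempotents e)
    (ht : ∀ u v, u < v → ∀ a, e v * a * e u = 0) (i j : ι) (c b a : A) :
    cornerHom (K := K) he ht i j c (cornerMk K (e i) (e j) b a) =
      cornerMk K (e i) (e j) (e i * c * e i * b) a :=
  cornerAct_mk (he.idem i).eq _ _ _ _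

/-- The direct sum of the regular representation and the corner tensor product. -/
def regularRep (he : CompleteOrthogonalIdempotents e)
    (ht : ∀ u v, u < v → ∀ a, e v * a * e u = 0) (i j : ι) :
    A →ₐ[K] Module.End K (A × CornerTensor (K := K) (e i) (e j)) :=
  AlgHom.ofLinearMap
    { toFun := fun c => (LinearMap.mulLeft K c).prodMap (cornerHom he ht i j c)
      map_add' := fun c d => by ext y <;> simp [add_mul]
      map_smul' := fun r c => by ext y <;> simp }
    (by ext y <;> simp)
    (by intro c d; ext y <;> simp)

lemma regularRep_apply (he : CompleteOrthogonalIdempotents e)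
    (ht : ∀ u v, u < v → ∀ a, e v * a * e u = 0) (i j : ι) (c a : A)
    (y : CornerTensor (K := K) (e i) (e j)) :
    regularRep he ht i j c (a, y) = (c * a, cornerHom he ht i j c y) := rfl

/-- Right multiplication by a fixed element, into the corner tensor product. -/
def cornerMkRight (K : Type) [Field K] {A : Type} [Ring A] [Algebra K A] (p q b : A) :
    A →ₗ[K] CornerTensor (K := K) p q :=
  (cornerRel p q).mkQ.comp (TensorProduct.mk K A A b)

lemma cornerMkRight_apply (p q b a : A) : cornerMkRight K p q b a = cornerMk K p q b a := rfl

lemma cornerMk_corner_mul_diagHom (he : CompleteOrthogonalIdempotents e)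
    (ht : ∀ u v, u < v → ∀ a, e v * a * e u = 0) (i j : ι) (c d a : A) :
    cornerMk K (e i) (e j) (e i * c * e j) (diagHom (K := K) he ht d * a) =
      cornerMk K (e i) (e j) (e i * c * e j * (e j * d * e j)) a := by
  have h1 := cornerMk_balanced (K := K) (e i) (e j) (e i * c * e j) (e j)
    (diagHom (K := K) he ht d * a)
  rw [cornerMk_balanced, ← mul_diagHom (K := K) he ht]
  simp only [(he.idem j).eq, mul_assoc] at h1 ⊢
  exact h1

/-- The representation in which only the maps from the vertex `j` to the vertex `i` are kept,
and are made universal by mapping to the corner tensor product. -/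
def inducedRep (he : CompleteOrthogonalIdempotents e)
    (ht : ∀ u v, u < v → ∀ a, e v * a * e u = 0) {i j : ι} (hij : i ⋖ j) :
    A →ₐ[K] Module.End K (A × CornerTensor (K := K) (e i) (e j)) :=
  AlgHom.ofLinearMap
    { toFun := fun c => (LinearMap.mulLeft K (diagHom (K := K) he ht c)).prodMap
          (cornerHom he ht i j c) +
        (LinearMap.inr K A _).comp
          ((cornerMkRight K (e i) (e j) (e i * c * e j)).comp (LinearMap.fst K A _))
      map_add' := fun c d => by
        refine LinearMap.ext fun ⟨a, y⟩ => ?_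
        ext <;> simp [add_mul, mul_add, cornerMkRight_apply, cornerMk_add_left]
        abel
      map_smul' := fun r c => by
        refine LinearMap.ext fun ⟨a, y⟩ => ?_
        ext <;> simp [cornerMkRight_apply, cornerMk_smul_left] }
    (by
      refine LinearMap.ext fun ⟨a, y⟩ => ?_
      ext <;> simp [cornerMkRight_apply, he.ortho hij.ne, cornerMk_zero_left])
    (by
      intro c d
      refine LinearMap.ext fun ⟨a, y⟩ => ?_
      ext
      · simp [mul_assoc]
      · simp only [LinearMap.coe_mk, AddHom.coe_mk, Module.End.mul_apply, LinearMap.add_apply,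
          LinearMap.prodMap_apply, LinearMap.mulLeft_apply, LinearMap.comp_apply,
          LinearMap.fst_apply, LinearMap.inr_apply, Prod.snd_add, map_mul, map_add,
          cornerMkRight_apply, corner_mul_of_covBy he ht hij c d, cornerMk_add_left,
          cornerHom_mk, cornerMk_corner_mul_diagHom, cornerMk_zero_right, add_zero]
        abel)

lemma inducedRep_apply (he : CompleteOrthogonalIdempotents e)
    (ht : ∀ u v, u < v → ∀ a, e v * a * e u = 0) {i j : ι} (hij : i ⋖ j) (c a : A)
    (y : CornerTensor (K := K) (e i) (e j)) :
    inducedRep he ht hij c (a, y) = (diagHom (K := K) he ht c * a,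
      cornerHom he ht i j c y + cornerMk K (e i) (e j) (e i * c * e j) a) := by
  simp [inducedRep, cornerMkRight_apply]

lemma cornerHom_eq_zero (he : CompleteOrthogonalIdempotents e)
    (ht : ∀ u v, u < v → ∀ a, e v * a * e u = 0) (i j : ι) {c : A} (hc : e i * c * e i = 0)
    (y : CornerTensor (K := K) (e i) (e j)) : cornerHom he ht i j c y = 0 := by
  induction y using corner_induction with
  | mk b a => rw [cornerHom_mk, hc, zero_mul, cornerMk_zero_left]
  | add y z hy hz => rw [map_add, hy, hz, add_zero]

/-- The map `b ↦ p * b * q`. -/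
def compress (K : Type) [Field K] {A : Type} [Ring A] [Algebra K A] (p q : A) : A →ₗ[K] A :=
  (LinearMap.mulLeft K p).comp (LinearMap.mulRight K q)

lemma compress_apply (p q b : A) : compress K p q b = p * b * q := by
  simp [compress, mul_assoc]

/-- The map `b ⊗ x ↦ (p * b * q) • x` for a representation of `A` on `X`. -/
def compressedAct {X : Type} [AddCommGroup X] [Module K X] (p q : A)
    (Ψ : A →ₐ[K] Module.End K X) : A ⊗[K] X →ₗ[K] X :=
  TensorProduct.lift (Ψ.toLinearMap.comp (compress K p q))

lemma compressedAct_tmul {X : Type} [AddCommGroup X] [Module K X] (p q : A)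
    (Ψ : A →ₐ[K] Module.End K X) (b : A) (x : X) :
    compressedAct p q Ψ (b ⊗ₜ x) = Ψ (p * b * q) x := by
  simp [compressedAct, compress_apply]

/-- The tensors in `A ⊗ X` which are killed by `compressedAct` for formal reasons. -/
def balancedTensor {X : Type} [AddCommGroup X] [Module K X] (p q : A)
    (Ψ : A →ₐ[K] Module.End K X) : (A × A × X) ⊕ (A × X) → A ⊗[K] X
  | Sum.inl (b, g, x) => (b * (q * g * q)) ⊗ₜ x - b ⊗ₜ Ψ (q * g * q) x
  | Sum.inr (b, x) => b ⊗ₜ x - (p * b * q) ⊗ₜ x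

/-- The action of `A` on a vector `x`, applied to the second factor of a tensor. -/
def orbitTensor {X : Type} [AddCommGroup X] [Module K X]
    (Ψ : A →ₐ[K] Module.End K X) (θ : A ⊗[K] A) (x : X) : A ⊗[K] X :=
  LinearMap.lTensor A ((LinearMap.applyₗ x).comp Ψ.toLinearMap) θ

lemma compressedAct_balancedTensor {X : Type} [AddCommGroup X] [Module K X] {p q : A}
    (hp : p * p = p) (hq : q * q = q) (Ψ : A →ₐ[K] Module.End K X)
    (k : (A × A × X) ⊕ (A × X)) :
    compressedAct p q Ψ (balancedTensor p q Ψ k) = 0 := by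
  rcases k with ⟨b, g, x⟩ | ⟨b, x⟩
  · rw [balancedTensor, map_sub, compressedAct_tmul, compressedAct_tmul, ← Module.End.mul_apply,
      ← map_mul, sub_eq_zero]
    congr 2
    simp only [mul_assoc, hq, ← mul_assoc q q]
  · rw [balancedTensor, map_sub, compressedAct_tmul, compressedAct_tmul, sub_eq_zero]
    congr 2
    simp only [mul_assoc, hq, ← mul_assoc p p, hp]

lemma compressedAct_orbitTensor {X : Type} [AddCommGroup X] [Module K X] (p q : A)
    (Ψ : A →ₐ[K] Module.End K X) (θ : A ⊗[K] A) (x : X) :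
    compressedAct p q Ψ (orbitTensor Ψ θ x) =
      Ψ (compressedAct p q (Algebra.lmul K A) θ) x := by
  induction θ with
  | zero => simp [orbitTensor]
  | tmul b a =>
    simp [orbitTensor, compressedAct_tmul]
  | add s t hs ht =>
    simp only [orbitTensor, map_add, LinearMap.add_apply] at hs ht ⊢
    rw [hs, ht]

omit [Fintype ι] [LinearOrder ι] in
lemma coeff_compressedAct_mem (X : Type) [AddCommGroup X] [Module K X]
    (P : ι → Module.End K X) (p q : A) (w : A ⊗[K] X) (l : Module.Dual K X) :
    (fun Ψ : RepsWith e X P => l (compressedAct p q Ψ.1 w)) ∈ coeffAlgebra e X P := by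
  induction w with
  | zero =>
    simp only [map_zero]
    exact (coeffAlgebra e X P).zero_mem
  | tmul b x => simpa only [compressedAct_tmul] using coeff_mem e X P _ l x
  | add s t hs ht =>
    simp only [map_add]
    exact add_mem hs ht

omit [Fintype ι] [LinearOrder ι] in
lemma coeff_tmul_mem (X : Type) [AddCommGroup X] [Module K X]
    (P : ι → Module.End K X) (b a : A) (x : X) (l : Module.Dual K (A ⊗[K] X)) :
    (fun Ψ : RepsWith e X P => l (b ⊗ₜ Ψ.1 a x)) ∈ coeffAlgebra e X P :=
  coeff_mem e X P a (l.comp (TensorProduct.mk K A X b)) x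

omit [Fintype ι] [LinearOrder ι] in
lemma coeff_balancedTensor_mem (X : Type) [AddCommGroup X] [Module K X]
    (P : ι → Module.End K X) (p q : A) (k : (A × A × X) ⊕ (A × X))
    (l : Module.Dual K (A ⊗[K] X)) :
    (fun Ψ : RepsWith e X P => l (balancedTensor p q Ψ.1 k)) ∈ coeffAlgebra e X P := by
  rcases k with ⟨b, g, x⟩ | ⟨b, x⟩
  · simp only [balancedTensor, map_sub]
    exact sub_mem ((coeffAlgebra e X P).algebraMap_mem (l ((b * (q * g * q)) ⊗ₜ x)))
      (coeff_tmul_mem X P _ _ _ _)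
  · exact (coeffAlgebra e X P).algebraMap_mem (l (b ⊗ₜ x - (p * b * q) ⊗ₜ x))

omit [Fintype ι] [LinearOrder ι] in
lemma coeff_orbitTensor_mem (X : Type) [AddCommGroup X] [Module K X]
    (P : ι → Module.End K X) (θ : A ⊗[K] A) (x : X) (l : Module.Dual K (A ⊗[K] X)) :
    (fun Ψ : RepsWith e X P => l (orbitTensor Ψ.1 θ x)) ∈ coeffAlgebra e X P := by
  induction θ with
  | zero =>
    simp only [orbitTensor, map_zero]
    exact (coeffAlgebra e X P).zero_mem
  | tmul b a => exact coeff_tmul_mem X P b a x l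
  | add s t hs ht =>
    simp only [orbitTensor, map_add]
    exact add_mem hs ht

lemma mem_cornerRel_of_lTensor_inl_mem (he : CompleteOrthogonalIdempotents e)
    (ht : ∀ u v, u < v → ∀ a, e v * a * e u = 0) (i j : ι) (θ : A ⊗[K] A)
    (h : LinearMap.lTensor A (LinearMap.inl K A (CornerTensor (K := K) (e i) (e j))) θ ∈
      Submodule.span K (Set.range
        (balancedTensor (e i) (e j) (regularRep (K := K) he ht i j)))) :
    θ ∈ cornerRel (e i) (e j) := by
  have key : Submodule.span K (Set.range
        (balancedTensor (e i) (e j) (regularRep (K := K) he ht i j))) ≤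
      (cornerRel (e i) (e j)).comap (LinearMap.lTensor A (LinearMap.fst K A _)) := by
    rw [Submodule.span_le]
    rintro _ ⟨⟨b, g, a, y⟩ | ⟨b, a, y⟩, rfl⟩
    · exact Submodule.subset_span (Or.inr ⟨b, g, a, by
        simp [balancedTensor, regularRep_apply, mul_assoc]⟩)
    · exact Submodule.subset_span (Or.inl ⟨b, a, by simp [balancedTensor]⟩)
  have := key h
  rwa [Submodule.mem_comap, ← LinearMap.comp_apply, ← LinearMap.lTensor_comp,
    LinearMap.fst_comp_inl, LinearMap.lTensor_id] at this

lemma ker_compressedAct_inducedRep_le (he : CompleteOrthogonalIdempotents e)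
    (ht : ∀ u v, u < v → ∀ a, e v * a * e u = 0) {i j : ι} (hij : i ⋖ j) :
    LinearMap.ker (compressedAct (e i) (e j) (inducedRep (K := K) he ht hij)) ≤
      Submodule.span K (Set.range
        (balancedTensor (e i) (e j) (regularRep (K := K) he ht i j))) := by
  set U := Submodule.span K (Set.range
        (balancedTensor (e i) (e j) (regularRep (K := K) he ht i j))) with hU
  set κ : A ⊗[K] (A × CornerTensor (K := K) (e i) (e j)) →ₗ[K] A ⊗[K] A :=
    TensorProduct.map (compress K (e i) (e j)) (LinearMap.fst K A _)
  have hjij : e i * e j * e i = 0 := by rw [he.ortho hij.ne, zero_mul]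
  have h1 : ∀ w, w - LinearMap.lTensor A (LinearMap.inl K A _) (κ w) ∈ U := by
    intro w
    induction w with
    | zero => simp
    | tmul b x =>
      obtain ⟨a, y⟩ := x
      have m1 : balancedTensor (e i) (e j) (regularRep (K := K) he ht i j)
        (Sum.inr (b, (a, y))) ∈ U := Submodule.subset_span ⟨_, rfl⟩
      have m2 : balancedTensor (e i) (e j) (regularRep (K := K) he ht i j)
        (Sum.inl (e i * b * e j, e j, (0, y))) ∈ U := Submodule.subset_span ⟨_, rfl⟩
      have e2 : balancedTensor (e i) (e j) (regularRep (K := K) he ht i j)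
          (Sum.inl (e i * b * e j, e j, (0, y))) = (e i * b * e j) ⊗ₜ (0, y) := by
        simp only [balancedTensor, regularRep_apply, (he.idem j).eq, mul_zero, mul_assoc,
          cornerHom_eq_zero he ht i j hjij, Prod.mk_zero_zero, TensorProduct.tmul_zero, sub_zero]
      have e3 : ((a, y) : A × CornerTensor (K := K) (e i) (e j)) = (a, 0) + (0, y) := by simp
      rw [e2] at m2
      convert add_mem m1 m2 using 1
      simp only [κ, balancedTensor, TensorProduct.map_tmul, compress_apply, LinearMap.fst_apply,
        LinearMap.lTensor_tmul, LinearMap.inl_apply]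
      conv_rhs => rw [e3, TensorProduct.tmul_add (e i * b * e j)]
      rw [← e3]
      abel
    | add s t hs ht =>
      convert add_mem hs ht using 1
      simp only [map_add]
      abel
  have h2 : cornerRel (e i) (e j) ≤ U.comap
      (LinearMap.lTensor A (LinearMap.inl K A (CornerTensor (K := K) (e i) (e j)))) := by
    refine Submodule.span_le.2 ?_
    rintro _ (⟨b, a, rfl⟩ | ⟨b, g, a, rfl⟩)
    · exact Submodule.subset_span ⟨Sum.inr (b, (a, 0)), by simp [balancedTensor]⟩
    · exact Submodule.subset_span ⟨Sum.inl (b, g, (a, 0)),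
        by simp [balancedTensor, regularRep_apply, mul_assoc]⟩
  have h3 : ∀ w, compressedAct (e i) (e j) (inducedRep (K := K) he ht hij) w =
      (0, (cornerRel (e i) (e j)).mkQ (κ w)) := by
    intro w
    induction w with
    | zero => simp only [map_zero, Prod.mk_zero_zero]
    | tmul b x =>
      obtain ⟨a, y⟩ := x
      have hz : e i * (e i * b * e j) * e i = 0 := by
        simp only [mul_assoc, he.ortho hij.ne', mul_zero]
      have hs : e i * (e i * b * e j) * e j = e i * b * e j := by
        simp only [← mul_assoc, (he.idem i).eq]
        simp only [mul_assoc, (he.idem j).eq]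
      rw [compressedAct_tmul, inducedRep_apply, diagHom_off_diagonal he ht hij.ne, zero_mul,
        cornerHom_eq_zero he ht i j hz, zero_add, hs]
      simp [κ, compress_apply, cornerMk]
    | add s t hs ht => rw [map_add, hs, ht]; simp
  intro w hw
  rw [LinearMap.mem_ker, h3] at hw
  have hκ : κ w ∈ cornerRel (e i) (e j) := by
    simpa using congrArg Prod.snd hw
  simpa using add_mem (h1 w) (h2 hκ)

/-- If the variety of representations of `A` on any vector space is irreducible, then
multiplication identifies the corner tensor product with a subspace of `A`. -/
theorem mem_cornerRel_of_compressedAct_eq_zero [Module.Finite K A]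
    (he : CompleteOrthogonalIdempotents e)
    (ht : ∀ u v, u < v → ∀ a, e v * a * e u = 0) {i j : ι} (hij : i ⋖ j)
    (hirr : ∀ (X : Type) [AddCommGroup X] [Module K X] [Module.Finite K X]
      (P : ι → Module.End K X), ∀ F ∈ coeffAlgebra e X P, ∀ G ∈ coeffAlgebra e X P,
        F * G = 0 → F = 0 ∨ G = 0)
    (θ : A ⊗[K] A) (hθ : compressedAct (e i) (e j) (Algebra.lmul K A) θ = 0) :
    θ ∈ cornerRel (e i) (e j) := by
  by_contra hmem
  let X := A × CornerTensor (K := K) (e i) (e j)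
  let P : ι → Module.End K X := fun v => regularRep (K := K) he ht i j (e v)
  let ω₁ : RepsWith e X P := ⟨regularRep he ht i j, fun v => rfl⟩
  let ω₂ : RepsWith e X P := ⟨inducedRep he ht hij, fun v => by
    refine LinearMap.ext fun ⟨a, y⟩ => ?_
    have h0 : e i * e v * e j = 0 := by
      by_cases h : i = v
      · subst h; rw [(he.idem i).eq, he.ortho hij.ne]
      · rw [he.ortho h, zero_mul]
    rw [inducedRep_apply, h0, cornerMk_zero_left, add_zero, diagHom_idempotent]
    rfl⟩
  let U := Submodule.span K (Set.range (balancedTensor (e i) (e j) ω₁.1))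
  let u : RepsWith e X P → ((A × A × X) ⊕ (A × X)) ⊕ X → A ⊗[K] X := fun Ψ =>
    Sum.elim (balancedTensor (e i) (e j) Ψ.1) (orbitTensor Ψ.1 θ)
  let T : RepsWith e X P → A ⊗[K] X →ₗ[K] X := fun Ψ => compressedAct (e i) (e j) Ψ.1
  have hTu : ∀ Ψ k, T Ψ (u Ψ k) = 0 := by
    rintro Ψ (k | x)
    · exact compressedAct_balancedTensor (he.idem i).eq (he.idem j).eq Ψ.1 k
    · change compressedAct _ _ _ (orbitTensor _ _ _) = 0
      rw [compressedAct_orbitTensor, hθ, map_zero, LinearMap.zero_apply]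
  have hU : U < Submodule.span K (Set.range (u ω₁)) := by
    refine lt_of_le_of_ne (Submodule.span_mono ?_) fun h => hmem ?_
    · rintro _ ⟨k, rfl⟩
      exact ⟨Sum.inl k, rfl⟩
    · refine mem_cornerRel_of_lTensor_inl_mem he ht i j θ ?_
      change _ ∈ U
      rw [h]
      refine Submodule.subset_span ⟨Sum.inr (1, 0), ?_⟩
      change LinearMap.lTensor A _ θ = _
      congr 2
      refine LinearMap.ext fun a => ?_
      change regularRep (K := K) he ht i j a (1, 0) = (a, 0)
      rw [regularRep_apply, mul_one, map_zero]
  obtain ⟨κ₁, k₁, -, hk₁, hli₁⟩ := exists_linearIndependent' K (u ω₁)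
  obtain ⟨κ₂, k₂, -, hk₂, hli₂⟩ := exists_linearIndependent' K (T ω₂)
  have : Finite κ₁ := hli₁.finite
  have : Finite κ₂ := hli₂.finite
  let _ := Fintype.ofFinite κ₁
  let _ := Fintype.ofFinite κ₂
  have hc₁ : Module.finrank K U < Fintype.card κ₁ := by
    rw [← finrank_span_eq_card hli₁, hk₁]
    exact Submodule.finrank_lt_finrank_of_lt hU
  have hc₂ : Module.finrank K (LinearMap.range (T ω₂)) = Fintype.card κ₂ := by
    rw [← finrank_span_eq_card hli₂, hk₂, ← LinearMap.coe_range, Submodule.span_eq]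
  have hker : Module.finrank K (LinearMap.ker (T ω₂)) ≤ Module.finrank K U :=
    Submodule.finrank_mono (ker_compressedAct_inducedRep_le he ht hij)
  have hrn := LinearMap.finrank_range_add_finrank_ker (T ω₂)
  obtain ⟨F, hF, hF₁, hFli⟩ := exists_mem_ne_zero_linearIndependent (coeffAlgebra e X P)
    (fun k Ψ => u Ψ (k₁ k)) (fun k l => by
      change (fun Ψ : RepsWith e X P => l (u Ψ (k₁ k))) ∈ _
      rcases k₁ k with m | x
      · exact coeff_balancedTensor_mem X P _ _ m l
      · exact coeff_orbitTensor_mem X P θ x l) ω₁ hli₁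
  obtain ⟨G, hG, hG₂, hGli⟩ := exists_mem_ne_zero_linearIndependent (coeffAlgebra e X P)
    (fun k Ψ => T Ψ (k₂ k)) (fun k l => coeff_compressedAct_mem X P _ _ _ l) ω₂ hli₂
  obtain ⟨Ψ, hΨ⟩ : ∃ Ψ, F Ψ * G Ψ ≠ 0 := by
    by_contra! h
    rcases hirr X P F hF G hG (funext h) with h | h
    · exact hF₁ (congrFun h _)
    · exact hG₂ (congrFun h _)
  have h₁ := hFli Ψ (left_ne_zero_of_mul hΨ)
  have h₂ := hGli Ψ (right_ne_zero_of_mul hΨ)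
  have hl₁ : Fintype.card κ₁ ≤ Module.finrank K (LinearMap.ker (T Ψ)) := by
    rw [← finrank_span_eq_card h₁]
    refine Submodule.finrank_mono (Submodule.span_le.2 ?_)
    rintro _ ⟨k, rfl⟩
    exact hTu Ψ _
  have hl₂ : Fintype.card κ₂ ≤ Module.finrank K (LinearMap.range (T Ψ)) := by
    rw [← finrank_span_eq_card h₂]
    refine Submodule.finrank_mono (Submodule.span_le.2 ?_)
    rintro _ ⟨k, rfl⟩
    exact ⟨_, rfl⟩
  have hrn' := LinearMap.finrank_range_add_finrank_ker (T Ψ)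
  omega

end Triangular

end TriangularAlgebra

section RepresentationVariety

lemma completeOrthogonalIdempotents_vertexElem :
    CompleteOrthogonalIdempotents (vertexElem K Q) where
  idem i := by
    simpa [vertexElem, IsIdempotentElem] using RingQuot.mkAlgHom_rel K (PathRel.idem (K := K) i)
  ortho i j h := by
    simpa [vertexElem] using RingQuot.mkAlgHom_rel K (PathRel.orth (K := K) i j h)
  complete := by
    simpa [vertexElem] using RingQuot.mkAlgHom_rel K (PathRel.sum_one (K := K) (Q := Q))

lemma vertexElem_tgt_mul_arrowElem (a : Q.A) :
    vertexElem K Q (Q.tgt a) * arrowElem K Q a = arrowElem K Q a := by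
  simpa [vertexElem, arrowElem] using RingQuot.mkAlgHom_rel K (PathRel.tgt_mul (K := K) a)

lemma arrowElem_mul_vertexElem_src (a : Q.A) :
    arrowElem K Q a * vertexElem K Q (Q.src a) = arrowElem K Q a := by
  simpa [vertexElem, arrowElem] using RingQuot.mkAlgHom_rel K (PathRel.mul_src (K := K) a)

variable {K Q}

/-- The universal property of the path algebra. -/
def pathAlgebraLift {B : Type} [Ring B] [Algebra K B] {p : Q.V → B} (m : Q.A → B)
    (hp : CompleteOrthogonalIdempotents p) (ht : ∀ a, p (Q.tgt a) * m a = m a)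
    (hs : ∀ a, m a * p (Q.src a) = m a) : PathAlgebra K Q →ₐ[K] B :=
  RingQuot.liftAlgHom K ⟨FreeAlgebra.lift K (Sum.elim p m), by
    rintro _ _ (i | ⟨i, j, h⟩ | _ | a | a)
    · simpa using (hp.idem i).eq
    · simpa using hp.ortho h
    · simpa using hp.complete
    · simpa using ht a
    · simpa using hs a⟩

lemma pathAlgebraLift_vertexElem {B : Type} [Ring B] [Algebra K B] {p : Q.V → B} (m : Q.A → B)
    (hp : CompleteOrthogonalIdempotents p) (ht : ∀ a, p (Q.tgt a) * m a = m a)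
    (hs : ∀ a, m a * p (Q.src a) = m a) (v : Q.V) :
    pathAlgebraLift m hp ht hs (vertexElem K Q v) = p v := by
  simp [pathAlgebraLift, vertexElem]

lemma pathAlgebraLift_arrowElem {B : Type} [Ring B] [Algebra K B] {p : Q.V → B} (m : Q.A → B)
    (hp : CompleteOrthogonalIdempotents p) (ht : ∀ a, p (Q.tgt a) * m a = m a)
    (hs : ∀ a, m a * p (Q.src a) = m a) (a : Q.A) :
    pathAlgebraLift m hp ht hs (arrowElem K Q a) = m a := by
  simp [pathAlgebraLift, arrowElem]

lemma pathAlgebra_induction {C : PathAlgebra K Q → Prop} (scalar : ∀ r, C (algebraMap K _ r))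
    (vertex : ∀ v, C (vertexElem K Q v)) (arrow : ∀ a, C (arrowElem K Q a))
    (mul : ∀ x y, C x → C y → C (x * y)) (add : ∀ x y, C x → C y → C (x + y))
    (x : PathAlgebra K Q) : C x := by
  obtain ⟨z, rfl⟩ := RingQuot.mkAlgHom_surjective K (PathRel K Q) x
  induction z using FreeAlgebra.induction with
  | grade0 r => rw [AlgHom.commutes]; exact scalar r
  | grade1 y =>
    rcases y with v | a
    · exact vertex v
    · exact arrow a
  | mul y z hy hz => rw [map_mul]; exact mul _ _ hy hz
  | add y z hy hz => rw [map_add]; exact add _ _ hy hz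

lemma relEval_arrowElem {d : Q.V → ℕ}
    (f : PathAlgebra K Q →ₐ[K] Matrix (RepIx Q d) (RepIx Q d) K) (c : QPath Q →₀ K) :
    relEval K Q d (fun a => f (arrowElem K Q a)) c = f (relElem K Q c) := by
  simp [relEval, relElem, pathProd, pathElem, map_finsuppSum, map_list_prod, Function.comp_def]

lemma map_relElem {d : Q.V → ℕ} (f : PathAlgebra K Q →ₐ[K] Matrix (RepIx Q d) (RepIx Q d) K)
    {M : RepSpace K Q d} (hM : ∀ a, f (arrowElem K Q a) = M a) (c : QPath Q →₀ K) :
    f (relElem K Q c) = relEval K Q d M c := by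
  rw [← relEval_arrowElem]
  congr 1
  exact funext hM

lemma map_eq_zero_of_mem_twoSidedSpan {R B : Type} [Ring R] [Ring B] (f : R →+* B) {S : Set R}
    (hf : ∀ s ∈ S, f s = 0) {x : R} (hx : x ∈ twoSidedSpan R S) : f x = 0 := by
  have : AddSubgroup.closure {x | ∃ a b : R, ∃ s ∈ S, x = a * s * b} ≤
      (f : R →+ B).ker := by
    rw [AddSubgroup.closure_le]
    rintro _ ⟨a, b, s, hs, rfl⟩
    simp [AddMonoidHom.mem_ker, hf s hs]
  exact this hx

lemma exists_algHom_comp_eq {R A B : Type} [Ring R] [Algebra K R] [Ring A] [Algebra K A] [Ring B]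
    [Algebra K B] {φ : R →ₐ[K] A} (hφ : Function.Surjective φ) (f : R →ₐ[K] B)
    (h : ∀ x, φ x = 0 → f x = 0) : ∃ g : A →ₐ[K] B, ∀ x, g (φ x) = f x := by
  let g : A →+* B := (φ : R →+* A).liftOfRightInverse _ (Function.rightInverse_surjInv hφ)
    ⟨(f : R →+* B), fun x hx => h x hx⟩
  have hg : ∀ x, g (φ x) = f x := fun x =>
    (φ : R →+* A).liftOfRightInverse_comp_apply _ (Function.rightInverse_surjInv hφ)
      ⟨(f : R →+* B), fun x hx => h x hx⟩ x
  refine ⟨AlgHom.mk' g fun r a => ?_, hg⟩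
  obtain ⟨x, rfl⟩ := hφ a
  rw [← map_smul, hg, hg, map_smul]

/-- A basis adapted to a decomposition by idempotent endomorphisms. -/
lemma exists_basis_of_completeOrthogonalIdempotents {X ι : Type} [AddCommGroup X] [Module K X]
    [Module.Finite K X] [Fintype ι] [DecidableEq ι] {P : ι → Module.End K X}
    (hP : CompleteOrthogonalIdempotents P) :
    ∃ (d : ι → ℕ) (β : Module.Basis ((v : ι) × Fin (d v)) K X),
      ∀ u x, P u (β x) = if x.1 = u then β x else 0 := by
  have hInt : DirectSum.IsInternal fun v => LinearMap.range (P v) := by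
    rw [DirectSum.isInternal_submodule_iff_iSupIndep_and_iSup_eq_top]
    refine ⟨?_, ?_⟩
    · rw [iSupIndep_def]
      intro v
      rw [Submodule.disjoint_def]
      rintro _ ⟨x, rfl⟩ hx
      have : (⨆ j, ⨆ (_ : j ≠ v), LinearMap.range (P j)) ≤ LinearMap.ker (P v) := by
        refine iSup₂_le fun j hj => ?_
        rintro _ ⟨y, rfl⟩
        rw [LinearMap.mem_ker, ← Module.End.mul_apply, hP.ortho hj.symm, LinearMap.zero_apply]
      have h := this hx
      rwa [LinearMap.mem_ker, ← Module.End.mul_apply, (hP.idem v).eq] at h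
    · rw [eq_top_iff]
      intro x _
      have : x = ∑ v, P v x := by
        rw [← LinearMap.sum_apply, hP.complete, Module.End.one_apply]
      rw [this]
      exact sum_mem fun v _ => Submodule.mem_iSup_of_mem v ⟨x, rfl⟩
  refine ⟨_, hInt.collectedBasis fun v => Module.finBasis K (LinearMap.range (P v)), ?_⟩
  intro u x
  obtain ⟨y, hy⟩ := hInt.collectedBasis_mem
    (fun v => Module.finBasis K (LinearMap.range (P v))) x
  rw [← hy, ← Module.End.mul_apply]
  split_ifs with h
  · subst h; rw [(hP.idem _).eq]
  · rw [hP.ortho (Ne.symm h), LinearMap.zero_apply]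

lemma completeOrthogonalIdempotents_diagonal (d : Q.V → ℕ) :
    CompleteOrthogonalIdempotents fun v : Q.V =>
      (Matrix.diagonal fun x : RepIx Q d => if x.1 = v then (1 : K) else 0) where
  idem v := by
    simp [IsIdempotentElem]
  ortho u v h := by
    change Matrix.diagonal _ * Matrix.diagonal _ = 0
    rw [Matrix.diagonal_mul_diagonal, Matrix.diagonal_eq_zero]
    funext x
    by_cases hx : x.1 = u
    · simp [hx, h]
    · simp [hx]
  complete := by
    ext x y
    rw [Matrix.sum_apply, Matrix.one_apply]
    simp only [Matrix.diagonal_apply]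
    split_ifs <;> simp

variable {X : Type} [AddCommGroup X] [Module K X] {P : Q.V → Module.End K X} {d : Q.V → ℕ}
  (β : Module.Basis (RepIx Q d) K X)

lemma toMatrix_idempotent (hβ : ∀ u x, P u (β x) = if x.1 = u then β x else 0) (v : Q.V) :
    LinearMap.toMatrixAlgEquiv β (P v) =
      Matrix.diagonal fun x : RepIx Q d => if x.1 = v then 1 else 0 := by
  ext x y
  rw [LinearMap.toMatrixAlgEquiv_apply, hβ, Matrix.diagonal_apply]
  by_cases h : x = y
  · subst h
    rw [if_pos rfl]
    split_ifs <;> simp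
  · rw [if_neg h]
    split_ifs <;> simp [Ne.symm h]

variable {A : Type} [Ring A] [Algebra K A] (φ : PathAlgebra K Q →ₐ[K] A)

/-- The point of the representation variety given by a representation and a basis. -/
def repMatrices (Ψ : A →ₐ[K] Module.End K X) : RepSpace K Q d := fun a =>
  LinearMap.toMatrixAlgEquiv β (Ψ (φ (arrowElem K Q a)))

lemma repMatrices_mem (hβ : ∀ u x, P u (β x) = if x.1 = u then β x else 0)
    (Ψ : RepsWith (fun v => φ (vertexElem K Q v)) X P) :
    repMatrices β φ Ψ.1 ∈ RepSet K Q φ d := by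
  have hΨ := Ψ.2
  refine ⟨fun a u v h => ⟨?_, ?_⟩, fun c i j _ hc => ?_⟩
  · by_contra h'
    refine h ?_
    rw [repMatrices, ← vertexElem_tgt_mul_arrowElem, map_mul, map_mul, map_mul, hΨ,
      toMatrix_idempotent β hβ, Matrix.diagonal_mul, if_neg h', zero_mul]
  · by_contra h'
    refine h ?_
    rw [repMatrices, ← arrowElem_mul_vertexElem_src, map_mul, map_mul, map_mul, hΨ,
      toMatrix_idempotent β hβ, Matrix.mul_diagonal, if_neg h', mul_zero]
  · have := relEval_arrowElem (((LinearMap.toMatrixAlgEquiv β).toAlgHom.comp Ψ.1).comp φ) c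
    refine this.trans ?_
    simp [hc]

lemma exists_algHom_of_blockCompatible {M : RepSpace K Q d} (hM : BlockCompatible K Q d M) :
    ∃ f : PathAlgebra K Q →ₐ[K] Matrix (RepIx Q d) (RepIx Q d) K,
      (∀ a, f (arrowElem K Q a) = M a) ∧ ∀ v, f (vertexElem K Q v) =
        Matrix.diagonal fun x : RepIx Q d => if x.1 = v then 1 else 0 := by
  have ht (a : Q.A) : (Matrix.diagonal fun x : RepIx Q d => if x.1 = Q.tgt a then 1 else 0) *
      M a = M a := by
    ext x y
    rw [Matrix.diagonal_mul, ite_mul, one_mul, zero_mul]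
    split_ifs with h
    · rfl
    · by_contra h'
      exact h (hM a x y (Ne.symm h')).1
  have hs (a : Q.A) : M a * (Matrix.diagonal fun x : RepIx Q d =>
      if x.1 = Q.src a then 1 else 0) = M a := by
    ext x y
    rw [Matrix.mul_diagonal, mul_ite, mul_one, mul_zero]
    split_ifs with h
    · rfl
    · by_contra h'
      exact h (hM a x y (Ne.symm h')).2
  exact ⟨pathAlgebraLift M (completeOrthogonalIdempotents_diagonal d) ht hs,
    pathAlgebraLift_arrowElem _ _ _ _, pathAlgebraLift_vertexElem _ _ _ _⟩

lemma map_eq_zero_of_mem_repSet {S : Set (PathAlgebra K Q)} (hrel : ∀ x ∈ S, IsRelation K Q x)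
    (hgen : twoSidedSpan (PathAlgebra K Q) S = {x | φ x = 0})
    {M : RepSpace K Q d} (hM : M ∈ RepSet K Q φ d)
    (f : PathAlgebra K Q →ₐ[K] Matrix (RepIx Q d) (RepIx Q d) K)
    (hfM : ∀ a, f (arrowElem K Q a) = M a) (x : PathAlgebra K Q) (hx : φ x = 0) : f x = 0 := by
  have hx' : x ∈ twoSidedSpan (PathAlgebra K Q) S := by
    rw [hgen]; exact hx
  refine map_eq_zero_of_mem_twoSidedSpan f.toRingHom ?_ hx'
  intro s hs
  obtain ⟨c, i, j, hc, rfl⟩ := hrel s hs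
  have h0 : φ (relElem K Q c) = 0 := by
    have : relElem K Q c ∈ twoSidedSpan (PathAlgebra K Q) S :=
      AddSubgroup.subset_closure ⟨1, 1, _, hs, by simp⟩
    rwa [hgen] at this
  exact (map_relElem f hfM c).trans (hM.2 c i j hc h0)

lemma exists_repMatrices_eq (hφ : Function.Surjective φ)
    {S : Set (PathAlgebra K Q)} (hrel : ∀ x ∈ S, IsRelation K Q x)
    (hgen : twoSidedSpan (PathAlgebra K Q) S = {x | φ x = 0})
    (hβ : ∀ u x, P u (β x) = if x.1 = u then β x else 0)
    {M : RepSpace K Q d} (hM : M ∈ RepSet K Q φ d) :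
    ∃ Ψ : RepsWith (fun v => φ (vertexElem K Q v)) X P, repMatrices β φ Ψ.1 = M := by
  obtain ⟨f, hfM, hfv⟩ := exists_algHom_of_blockCompatible hM.1
  have hker := map_eq_zero_of_mem_repSet φ hrel hgen hM f hfM
  obtain ⟨g, hg⟩ := exists_algHom_comp_eq hφ f hker
  refine ⟨⟨(LinearMap.toMatrixAlgEquiv β).symm.toAlgHom.comp g, fun v => ?_⟩, ?_⟩
  · change (LinearMap.toMatrixAlgEquiv β).symm (g (φ (vertexElem K Q v))) = P v
    rw [hg, AlgEquiv.symm_apply_eq, toMatrix_idempotent β hβ, hfv]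
  · funext a
    change LinearMap.toMatrixAlgEquiv β
      ((LinearMap.toMatrixAlgEquiv β).symm (g (φ (arrowElem K Q a)))) = M a
    rw [AlgEquiv.apply_symm_apply, hg, hfM]

lemma exists_polynomial_of_mem_coeffAlgebra (hφ : Function.Surjective φ)
    {F : RepsWith (fun v => φ (vertexElem K Q v)) X P → K}
    (hF : F ∈ coeffAlgebra (fun v => φ (vertexElem K Q v)) X P) :
    ∃ f : MvPolynomial (Q.A × RepIx Q d × RepIx Q d) K, ∀ Ψ,
      F Ψ = MvPolynomial.eval (fun x => repMatrices β φ Ψ.1 x.1 x.2.1 x.2.2) f := by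
  let η : MvPolynomial (Q.A × RepIx Q d × RepIx Q d) K →ₐ[K]
      (RepsWith (fun v => φ (vertexElem K Q v)) X P → K) :=
    MvPolynomial.aeval fun x Ψ => repMatrices β φ Ψ.1 x.1 x.2.1 x.2.2
  have hη : ∀ f Ψ, η f Ψ =
      MvPolynomial.eval (fun x => repMatrices β φ Ψ.1 x.1 x.2.1 x.2.2) f := by
    intro f Ψ
    change Pi.evalRingHom _ Ψ (MvPolynomial.aeval _ f) = _
    rw [MvPolynomial.map_aeval]
    rfl
  have hentry : ∀ z u v, (fun Ψ : RepsWith (fun v => φ (vertexElem K Q v)) X P =>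
      LinearMap.toMatrixAlgEquiv β (Ψ.1 (φ z)) u v) ∈ η.range := by
    intro z
    induction z using pathAlgebra_induction with
    | scalar r =>
      intro u v
      simp only [AlgHom.commutes]
      exact η.range.algebraMap_mem
        (LinearMap.toMatrixAlgEquiv β (algebraMap K (Module.End K X) r) u v)
    | vertex w =>
      intro u v
      have : (fun Ψ : RepsWith (fun v => φ (vertexElem K Q v)) X P =>
          LinearMap.toMatrixAlgEquiv β (Ψ.1 (φ (vertexElem K Q w))) u v) =
          fun Ψ => LinearMap.toMatrixAlgEquiv β (P w) u v := by
        funext Ψ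
        rw [← Ψ.2 w]
      rw [this]
      exact η.range.algebraMap_mem (LinearMap.toMatrixAlgEquiv β (P w) u v)
    | arrow a =>
      intro u v
      exact ⟨MvPolynomial.X (a, u, v), by funext Ψ; exact (hη _ _).trans (by simp [repMatrices])⟩
    | mul x y hx hy =>
      intro u v
      simp only [map_mul, Matrix.mul_apply]
      have := sum_mem fun w (_ : w ∈ Finset.univ) => mul_mem (hx u w) (hy w v)
      convert this using 1
      funext Ψ
      simp
    | add x y hx hy =>
      intro u v
      simp only [map_add, Matrix.add_apply]
      exact add_mem (hx u v) (hy u v)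
  have hle : coeffAlgebra (fun v => φ (vertexElem K Q v)) X P ≤ η.range := by
    refine Algebra.adjoin_le ?_
    rintro _ ⟨a, l, x, rfl⟩
    obtain ⟨z, rfl⟩ := hφ a
    have : (fun Ψ : RepsWith (fun v => φ (vertexElem K Q v)) X P => l (Ψ.1 (φ z) x)) =
        ∑ v, ∑ u, (β.repr x v * l (β u)) • fun Ψ : RepsWith (fun v => φ (vertexElem K Q v)) X P =>
          LinearMap.toMatrixAlgEquiv β (Ψ.1 (φ z)) u v := by
      funext Ψ
      conv_lhs => rw [← β.sum_repr x]
      simp only [map_sum, map_smul, Finset.sum_apply, Pi.smul_apply]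
      refine Finset.sum_congr rfl fun v _ => ?_
      conv_lhs => rw [← β.sum_repr (Ψ.1 (φ z) (β v))]
      simp only [map_sum, map_smul, LinearMap.toMatrixAlgEquiv_apply, smul_eq_mul,
        Finset.mul_sum]
      refine Finset.sum_congr rfl fun u _ => ?_
      ring
    rw [this]
    exact sum_mem fun v _ => sum_mem fun u _ => η.range.smul_mem (hentry z u v) _
  obtain ⟨f, hf⟩ := hle hF
  exact ⟨f, fun Ψ => by rw [← hη]; exact congrFun hf.symm Ψ⟩

lemma isOpen_eval_ne_zero (f : MvPolynomial (Q.A × RepIx Q d × RepIx Q d) K) :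
    @IsOpen _ (repTopology K Q d)
      {M | MvPolynomial.eval (fun x => M x.1 x.2.1 x.2.2) f ≠ 0} :=
  ⟨_, TopologicalSpace.isOpen_generateFrom_of_mem ⟨f, rfl⟩, rfl⟩

theorem eq_zero_or_eq_zero_of_isGeomIrreducible (hφ : Function.Surjective φ)
    {S : Set (PathAlgebra K Q)} (hrel : ∀ x ∈ S, IsRelation K Q x)
    (hgen : twoSidedSpan (PathAlgebra K Q) S = {x | φ x = 0})
    (hirr : IsGeomIrreducible K Q φ)
    (X : Type) [AddCommGroup X] [Module K X] [Module.Finite K X] (P : Q.V → Module.End K X)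
    (F) (hF : F ∈ coeffAlgebra (fun v => φ (vertexElem K Q v)) X P)
    (G) (hG : G ∈ coeffAlgebra (fun v => φ (vertexElem K Q v)) X P) (hFG : F * G = 0) :
    F = 0 ∨ G = 0 := by
  by_contra! h
  obtain ⟨Ψ₁, h₁⟩ := Function.ne_iff.1 h.1
  obtain ⟨Ψ₂, h₂⟩ := Function.ne_iff.1 h.2
  have hP : CompleteOrthogonalIdempotents P := by
    have := (completeOrthogonalIdempotents_vertexElem K Q).map
      ((Ψ₁.1.comp φ) : PathAlgebra K Q →+* Module.End K X)
    convert this using 1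
    funext v
    exact (Ψ₁.2 v).symm
  obtain ⟨d, β, hβ⟩ := exists_basis_of_completeOrthogonalIdempotents hP
  obtain ⟨f, hf⟩ := exists_polynomial_of_mem_coeffAlgebra β φ hφ hF
  obtain ⟨g, hg⟩ := exists_polynomial_of_mem_coeffAlgebra β φ hφ hG
  obtain ⟨M, hM, hMf, hMg⟩ := (hirr d).2 _ _ (isOpen_eval_ne_zero f) (isOpen_eval_ne_zero g)
    ⟨repMatrices β φ Ψ₁.1, repMatrices_mem β φ hβ Ψ₁, fun h => h₁ ((hf Ψ₁).trans h)⟩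
    ⟨repMatrices β φ Ψ₂.1, repMatrices_mem β φ hβ Ψ₂, fun h => h₂ ((hg Ψ₂).trans h)⟩
  obtain ⟨Ψ, rfl⟩ := exists_repMatrices_eq β φ hφ hrel hgen hβ hM
  rcases mul_eq_zero.1 (congrFun hFG Ψ) with h0 | h0
  · exact hMf ((hf Ψ).symm.trans h0)
  · exact hMg ((hg Ψ).symm.trans h0)

end RepresentationVariety

section CornerLifting

open scoped TensorProduct

variable {K} {R A : Type} [Ring R] [Algebra K R] [Ring A] [Algebra K A]

/-- The map `b ⊗ a ↦ p * b * q * a * r`. -/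
def throughMap (K : Type) [Field K] {R : Type} [Ring R] [Algebra K R] (p q r : R) :
    R ⊗[K] R →ₗ[K] R :=
  (LinearMap.mul' K R).comp (TensorProduct.map (compress K p q) (LinearMap.mulRight K r))

lemma throughMap_tmul (p q r b a : R) :
    throughMap K p q r (b ⊗ₜ a) = p * b * q * (a * r) := by
  simp [throughMap, compress_apply]

lemma throughMap_rTensor (p q r x : R) (θ : R ⊗[K] R) :
    throughMap K p q r (LinearMap.rTensor R (LinearMap.mulLeft K (x * p)) θ) =
      p * x * throughMap K p q r θ := by
  induction θ with
  | zero => simp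
  | tmul b a => simp [throughMap_tmul, mul_assoc]
  | add y z hy hz => rw [map_add, map_add, hy, hz, map_add, mul_add]

lemma throughMap_lTensor (p q r s y : R) (θ : R ⊗[K] R) :
    throughMap K p q r (LinearMap.lTensor R (LinearMap.mulRight K (s * y)) θ) =
      throughMap K p q s θ * y * r := by
  induction θ with
  | zero => simp
  | tmul b a => simp [throughMap_tmul, mul_assoc]
  | add y z hy hz => rw [map_add, map_add, hy, hz, map_add, add_mul, add_mul]

/-- If multiplication from the corner tensor product is injective, then elements of the kernel
passing through an idempotent come from elements of the kernel ending there. -/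
lemma corner_mem_of_map_eq_zero {φ : R →ₐ[K] A} (hφ : Function.Surjective φ)
    (J : Submodule K R) (hJ : ∀ x ∈ J, ∀ a b, a * x * b ∈ J) {p q r : R}
    (hp : p * p = p) (hq : q * q = q) (hr : r * r = r)
    (hcore : ∀ θ : A ⊗[K] A, compressedAct (φ p) (φ q) (Algebra.lmul K A) θ = 0 →
      θ ∈ cornerRel (φ p) (φ q))
    (hpq : ∀ x, φ x = 0 → p * x * q ∈ J) (hqr : ∀ x, φ x = 0 → q * x * r ∈ J)
    {x : R} (hx : φ x = 0) (hmem : p * x * r ∈ LinearMap.range (throughMap K p q r)) :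
    p * x * r ∈ J := by
  obtain ⟨s, hs⟩ := φ.toLinearMap.exists_rightInverse_of_surjective
    (LinearMap.range_eq_top.2 hφ)
  replace hs : ∀ a, φ (s a) = a := fun a => DFunLike.congr_fun hs a
  obtain ⟨θ, hθ⟩ := hmem
  have hN : ∀ b b' a a', φ b = φ b' → φ a = φ a' →
      p * b * q * (a * r) - p * b' * q * (a' * r) ∈ J := by
    intro b b' a a' hb ha
    have h1 := hJ _ (hpq (b - b') (by rw [map_sub, hb, sub_self])) 1 (a * r)
    have h2 := hJ _ (hqr (a - a') (by rw [map_sub, ha, sub_self])) (p * b') 1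
    convert add_mem h1 h2 using 1
    noncomm_ring
  let μ : A ⊗[K] A →ₗ[K] R ⧸ J := J.mkQ.comp ((throughMap K p q r).comp (TensorProduct.map s s))
  have hμ : ∀ b a, μ (b ⊗ₜ a) = J.mkQ (p * s b * q * (s a * r)) := by
    intro b a
    simp [μ, throughMap_tmul]
  have hμrel : cornerRel (φ p) (φ q) ≤ LinearMap.ker μ := by
    refine Submodule.span_le.2 ?_
    rintro _ (⟨b, a, rfl⟩ | ⟨b, g, a, rfl⟩)
    · rw [SetLike.mem_coe, LinearMap.mem_ker, map_sub, hμ, hμ, ← map_sub, Submodule.mkQ_apply,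
        Submodule.Quotient.mk_eq_zero]
      convert hN (p * s b * q) (s (φ p * b * φ q)) (s a) (s a) (by simp [hs]) rfl using 2
      simp only [mul_assoc, hq, ← mul_assoc p p, hp]
    · rw [SetLike.mem_coe, LinearMap.mem_ker, map_sub, hμ, hμ, ← map_sub, Submodule.mkQ_apply,
        Submodule.Quotient.mk_eq_zero]
      have h1 := hN (s (b * (φ q * g * φ q))) (s b * (q * s g * q)) (s a) (s a)
        (by simp [hs]) rfl
      have h2 := hN (s b) (s b) (q * s g * q * s a) (s (φ q * g * φ q * a)) rfl (by simp [hs])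
      convert add_mem h1 h2 using 1
      rw [← sub_add_sub_cancel _ (p * (s b * (q * s g * q)) * q * (s a * r))]
      congr 2
      simp only [mul_assoc, ← mul_assoc q q, hq]
  let η : R ⊗[K] R →ₗ[K] A ⊗[K] A :=
    TensorProduct.map φ.toLinearMap (φ.toLinearMap.comp (LinearMap.mulRight K r))
  have h1 : ∀ z, compressedAct (φ p) (φ q) (Algebra.lmul K A) (η z) =
      φ (throughMap K p q r z) := by
    intro z
    induction z with
    | zero => simp
    | tmul b a => simp [η, compressedAct_tmul, throughMap_tmul]
    | add y z hy hz => rw [map_add, map_add, hy, hz, map_add, map_add]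
  have h2 : ∀ z, μ (η z) = J.mkQ (throughMap K p q r z) := by
    intro z
    induction z with
    | zero => simp
    | tmul b a =>
      rw [throughMap_tmul]
      change μ (φ b ⊗ₜ φ (a * r)) = _
      rw [hμ, ← sub_eq_zero, ← map_sub, Submodule.mkQ_apply, Submodule.Quotient.mk_eq_zero]
      convert hN (s (φ b)) b (s (φ (a * r))) (a * r) (hs _) (hs _) using 2
      rw [mul_assoc a, hr]
    | add y z hy hz => rw [map_add, map_add, hy, hz, map_add, map_add]
  have h3 := hμrel (hcore (η θ) (by rw [h1, hθ, map_mul, map_mul, hx, mul_zero, zero_mul]))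
  rwa [LinearMap.mem_ker, h2, hθ, Submodule.mkQ_apply, Submodule.Quotient.mk_eq_zero] at h3

/-- A two-sided ideal containing the parts of the kernel between vertices at distance at most
one contains the kernel. -/
lemma mem_of_map_eq_zero {n : ℕ} {E : Fin (n + 1) → R} (hE : CompleteOrthogonalIdempotents E)
    {φ : R →ₐ[K] A} (hφ : Function.Surjective φ)
    (hcore : ∀ i j : Fin (n + 1), i ⋖ j → ∀ θ : A ⊗[K] A,
      compressedAct (φ (E i)) (φ (E j)) (Algebra.lmul K A) θ = 0 →
        θ ∈ cornerRel (φ (E i)) (φ (E j)))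
    (hthrough : ∀ i j u : Fin (n + 1), i ⋖ j → j ≤ u → ∀ x,
      E i * x * E u ∈ LinearMap.range (throughMap K (E i) (E j) (E u)))
    (J : Submodule K R) (hJ : ∀ x ∈ J, ∀ a b, a * x * b ∈ J)
    (hone : ∀ i u : Fin (n + 1), (u : ℕ) ≤ i + 1 → ∀ x, φ x = 0 → E i * x * E u ∈ J)
    {x : R} (hx : φ x = 0) : x ∈ J := by
  have key : ∀ (d : ℕ) (i u : Fin (n + 1)), (u : ℕ) ≤ i + 1 + d →
      ∀ x, φ x = 0 → E i * x * E u ∈ J := by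
    intro d
    induction d with
    | zero => exact hone
    | succ d ih =>
      intro i u hu x hx
      by_cases hu' : (u : ℕ) ≤ i + 1
      · exact hone i u hu' x hx
      let j : Fin (n + 1) := ⟨i + 1, by omega⟩
      have hij : i ⋖ j := by
        rw [Fin.covBy_iff, Nat.covBy_iff_add_one_eq]
      exact corner_mem_of_map_eq_zero hφ J hJ (hE.idem i).eq (hE.idem j).eq (hE.idem u).eq
        (hcore i j hij) (hone i j le_rfl)
        (ih j u (by simp only [j]; omega)) hx
        (hthrough i j u hij (by rw [Fin.le_def]; simp only [j]; omega) x)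
  have : x = ∑ i, ∑ u, E i * x * E u := by
    simp only [← Finset.mul_sum, ← Finset.sum_mul, hE.complete, one_mul, mul_one]
  rw [this]
  exact sum_mem fun i _ => sum_mem fun u _ => key n i u (by omega) x hx

end CornerLifting

section LinearQuiver

open scoped TensorProduct

variable {K} {n : ℕ} {t : Fin n → ℕ}

/-- The vertex idempotents of the path algebra of the linear quiver. -/
def linearVertex (K : Type) [Field K] {n : ℕ} (t : Fin n → ℕ) :
    Fin (n + 1) → PathAlgebra K (LinearQuiver n t) :=
  vertexElem K (LinearQuiver n t)

lemma completeOrthogonalIdempotents_linearVertex :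
    CompleteOrthogonalIdempotents (linearVertex K t) :=
  completeOrthogonalIdempotents_vertexElem K (LinearQuiver n t)

lemma linearVertex_mul_linearVertex_mul {u v : Fin (n + 1)} (h : v ≠ u) (w : Fin (n + 1)) :
    linearVertex K t v * linearVertex K t w * linearVertex K t u = 0 := by
  have hE := completeOrthogonalIdempotents_linearVertex (K := K) (t := t)
  by_cases hv : v = w
  · rw [mul_assoc, hE.ortho (hv ▸ h), mul_zero]
  · rw [hE.ortho hv, zero_mul]

/-- The target of an arrow of the linear quiver. -/
def linearTgt : (LinearQuiver n t).A → Fin (n + 1) := (LinearQuiver n t).tgt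

/-- The source of an arrow of the linear quiver. -/
def linearSrc : (LinearQuiver n t).A → Fin (n + 1) := (LinearQuiver n t).src

lemma linearTgt_add_isRight (a : Fin (n + 1) ⊕ ((i : Fin n) × Fin (t i))) :
    (linearTgt (t := t) a : ℕ) + (if a.isRight then 1 else 0) = linearSrc (t := t) a := by
  rcases a with a | a <;> simp [linearTgt, linearSrc, LinearQuiver]

lemma linearTgt_le_linearSrc (a : (LinearQuiver n t).A) :
    (linearTgt a : ℕ) ≤ linearSrc a ∧ (linearSrc a : ℕ) ≤ linearTgt a + 1 := by
  have := linearTgt_add_isRight (t := t) a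
  split_ifs at this <;> omega

lemma linearVertex_mul_arrowElem_mul (i u : Fin (n + 1)) (a : (LinearQuiver n t).A)
    (h : linearVertex K t i * arrowElem K (LinearQuiver n t) a * linearVertex K t u ≠ 0) :
    i = linearTgt a ∧ u = linearSrc a := by
  constructor
  · by_contra hi
    refine h ?_
    rw [← vertexElem_tgt_mul_arrowElem, ← mul_assoc]
    erw [completeOrthogonalIdempotents_linearVertex.ortho hi]
    rw [zero_mul, zero_mul]
  · by_contra hu
    refine h ?_
    rw [← arrowElem_mul_vertexElem_src, mul_assoc, mul_assoc]
    erw [completeOrthogonalIdempotents_linearVertex.ortho (Ne.symm hu)]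
    rw [mul_zero, mul_zero]

lemma linearVertex_mul_mul_eq_zero (x : PathAlgebra K (LinearQuiver n t)) :
    ∀ u v : Fin (n + 1), u < v → linearVertex K t v * x * linearVertex K t u = 0 := by
  have hE := completeOrthogonalIdempotents_linearVertex (K := K) (t := t)
  induction x using pathAlgebra_induction with
  | scalar r =>
    intro u v h
    rw [mul_assoc, Algebra.commutes, ← mul_assoc, hE.ortho h.ne', zero_mul]
  | vertex w =>
    intro u v h
    exact linearVertex_mul_linearVertex_mul h.ne' w
  | arrow a =>
    intro u v h
    by_contra h'
    obtain ⟨rfl, rfl⟩ := linearVertex_mul_arrowElem_mul v u a h'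
    exact absurd (linearTgt_le_linearSrc a).1 (not_le.2 h)
  | mul x y hx hy =>
    intro u v h
    rw [← sum_mul_idempotent_mul hE x y, Finset.mul_sum, Finset.sum_mul]
    refine Finset.sum_eq_zero fun w _ => ?_
    rcases lt_or_ge w v with hw | hw
    · rw [← mul_assoc, ← mul_assoc, hx w v hw, zero_mul, zero_mul]
    · have := hy u w (h.trans_le hw)
      simp only [mul_assoc] at this ⊢
      rw [this, mul_zero, mul_zero]
  | add x y hx hy =>
    intro u v h
    rw [mul_add, add_mul, hx u v h, hy u v h, add_zero]

lemma linearVertex_mul_mul_mem_range_throughMap (x : PathAlgebra K (LinearQuiver n t)) :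
    ∀ i j u : Fin (n + 1), i ⋖ j → j ≤ u → linearVertex K t i * x * linearVertex K t u ∈
      LinearMap.range
        (throughMap K (linearVertex K t i) (linearVertex K t j) (linearVertex K t u)) := by
  have hE := completeOrthogonalIdempotents_linearVertex (K := K) (t := t)
  induction x using pathAlgebra_induction with
  | scalar r =>
    intro i j u hij hu
    rw [mul_assoc, Algebra.commutes, ← mul_assoc, hE.ortho (hij.lt.trans_le hu).ne, zero_mul]
    exact zero_mem _
  | vertex w =>
    intro i j u hij hu
    have h := linearVertex_mul_linearVertex_mul (K := K) (t := t) (hij.lt.trans_le hu).ne w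
    exact ⟨0, (map_zero _).trans h.symm⟩
  | arrow a =>
    intro i j u hij hu
    by_cases h : linearVertex K t i * arrowElem K (LinearQuiver n t) a * linearVertex K t u = 0
    · rw [h]
      exact zero_mem _
    have h' := linearVertex_mul_arrowElem_mul i u a h
    have hju : u = j := by
      have h1 := (linearTgt_le_linearSrc a).2
      rw [← h'.1, ← h'.2] at h1
      have h2 := hij.lt
      rw [Fin.lt_def] at h2
      rw [Fin.le_def] at hu
      exact Fin.ext (by omega)
    subst hju
    refine ⟨arrowElem K (LinearQuiver n t) a ⊗ₜ 1, ?_⟩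
    rw [throughMap_tmul, one_mul, mul_assoc, (hE.idem u).eq]
  | mul x y hx hy =>
    intro i j u hij hu
    rw [← sum_mul_idempotent_mul hE x y, Finset.mul_sum, Finset.sum_mul]
    refine sum_mem fun w _ => ?_
    rcases lt_trichotomy w i with hw | rfl | hw
    · rw [← mul_assoc, ← mul_assoc, linearVertex_mul_mul_eq_zero x w i hw, zero_mul, zero_mul]
      exact zero_mem _
    · obtain ⟨θ, hθ⟩ := hy w j u hij hu
      refine ⟨LinearMap.rTensor _ (LinearMap.mulLeft K (x * linearVertex K t w)) θ, ?_⟩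
      rw [throughMap_rTensor, hθ]
      simp only [mul_assoc]
    · obtain ⟨θ, hθ⟩ := hx i j w hij (not_lt.1 fun h => hij.2 hw h)
      refine ⟨LinearMap.lTensor _ (LinearMap.mulRight K (linearVertex K t w * y)) θ, ?_⟩
      rw [throughMap_lTensor, hθ]
      simp only [← mul_assoc]
  | add x y hx hy =>
    intro i j u hij hu
    rw [mul_add, add_mul]
    exact add_mem (hx i j u hij hu) (hy i j u hij hu)

lemma pathDegree_add_tgt (p : QPath (LinearQuiver n t)) {i j : Fin (n + 1)} (hi : p.tgt = i)
    (hj : p.src = j) : pathDegree p + (i : ℕ) = j := by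
  obtain ⟨l, hl, hc⟩ := p
  subst hi hj
  change l.countP (fun a => a.isRight) + (linearTgt (l.head hl) : ℕ) = linearSrc (l.getLast hl)
  induction l with
  | nil => exact absurd rfl hl
  | cons a l ih =>
    have ha := linearTgt_add_isRight (t := t) a
    rcases l with _ | ⟨b, l⟩
    · simp only [List.countP_cons, List.countP_nil, List.head_cons, List.getLast_singleton]
      omega
    · have h1 := ih (List.cons_ne_nil b l) hc.tail
      have h2 : (linearSrc a : ℕ) = linearTgt b :=
        congrArg Fin.val (List.isChain_cons_cons.1 hc).1
      rw [List.countP_cons, List.getLast_cons (List.cons_ne_nil b l), ← h1]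
      simp only [List.head_cons]
      omega

lemma vertexElem_mul_pathElem_mul {Q : FinQuiver} (p : QPath Q) :
    vertexElem K Q p.tgt * pathElem K Q p * vertexElem K Q p.src = pathElem K Q p := by
  obtain ⟨l, hl, hc⟩ := p
  have h1 : vertexElem K Q (Q.tgt (l.head hl)) * (l.map (arrowElem K Q)).prod =
      (l.map (arrowElem K Q)).prod := by
    obtain ⟨a, l, rfl⟩ := List.exists_cons_of_ne_nil hl
    rw [List.head_cons, List.map_cons, List.prod_cons, ← mul_assoc, vertexElem_tgt_mul_arrowElem]
  have h2 : (l.map (arrowElem K Q)).prod * vertexElem K Q (Q.src (l.getLast hl)) =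
      (l.map (arrowElem K Q)).prod := by
    have h := congrArg (fun m => (m.map (arrowElem K Q)).prod) (List.dropLast_append_getLast hl)
    simp only [List.map_append, List.prod_append, List.map_cons, List.map_nil,
      List.prod_singleton] at h
    rw [← h, mul_assoc, arrowElem_mul_vertexElem_src]
  change vertexElem K Q (Q.tgt (l.head hl)) * (l.map (arrowElem K Q)).prod *
    vertexElem K Q (Q.src (l.getLast hl)) = (l.map (arrowElem K Q)).prod
  rw [h1, h2]

lemma vertexElem_mul_relElem_mul {Q : FinQuiver} {c : QPath Q →₀ K} {i j : Q.V}
    (hc : IsRelationData K Q c i j) :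
    vertexElem K Q i * relElem K Q c * vertexElem K Q j = relElem K Q c := by
  rw [relElem, Finsupp.sum, Finset.mul_sum, Finset.sum_mul]
  refine Finset.sum_congr rfl fun p hp => ?_
  obtain ⟨-, rfl, rfl⟩ := hc p hp
  rw [mul_smul_comm, smul_mul_assoc, vertexElem_mul_pathElem_mul]

lemma isDegreeLeOneRelation_of_le {c : QPath (LinearQuiver n t) →₀ K} {i j : Fin (n + 1)}
    (hc : IsRelationData K (LinearQuiver n t) c i j) (hij : (j : ℕ) ≤ i + 1) :
    IsDegreeLeOneRelation K (relElem K (LinearQuiver n t) c) := by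
  refine ⟨c, i, j, hc, fun p hp => ?_, rfl⟩
  have h := pathDegree_add_tgt p (hc p hp).2.1 (hc p hp).2.2
  omega

/-- The two-sided ideal generated by a set, as a subspace. -/
def twoSidedSubmodule (K : Type) [Field K] {R : Type} [Ring R] [Algebra K R] (S : Set R) :
    Submodule K R where
  __ := AddSubgroup.closure {x | ∃ a b : R, ∃ s ∈ S, x = a * s * b}
  smul_mem' r x hx := by
    refine (AddSubgroup.closure_le (K := (AddSubgroup.closure
      {x | ∃ a b : R, ∃ s ∈ S, x = a * s * b}).comap
        (DistribSMul.toAddMonoidHom R r))).2 ?_ hx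
    rintro _ ⟨a, b, s, hs, rfl⟩
    exact AddSubgroup.subset_closure ⟨r • a, b, s, hs, by simp⟩

lemma mul_mul_mem_twoSidedSubmodule {R : Type} [Ring R] [Algebra K R] {S : Set R} {x : R}
    (hx : x ∈ twoSidedSubmodule K S) (a b : R) : a * x * b ∈ twoSidedSubmodule K S := by
  refine (AddSubgroup.closure_le (K := (AddSubgroup.closure
    {x | ∃ a b : R, ∃ s ∈ S, x = a * s * b}).comap
      ((AddMonoidHom.mulRight b).comp (AddMonoidHom.mulLeft a)))).2 ?_ hx
  rintro _ ⟨c, d, s, hs, rfl⟩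
  exact AddSubgroup.subset_closure ⟨a * c, d * b, s, hs, by simp [mul_assoc]⟩

lemma linearVertex_mul_relElem_mul_mem {S : Set (PathAlgebra K (LinearQuiver n t))}
    {v u : Fin (n + 1)} (hvu : (u : ℕ) ≤ v + 1) {c : QPath (LinearQuiver n t) →₀ K}
    {i j : Fin (n + 1)} (hc : IsRelationData K (LinearQuiver n t) c i j)
    (hs : relElem K (LinearQuiver n t) c ∈ S) (a b : PathAlgebra K (LinearQuiver n t)) :
    linearVertex K t v * (a * relElem K (LinearQuiver n t) c * b) * linearVertex K t u ∈
      twoSidedSubmodule K {s ∈ S | IsDegreeLeOneRelation K s} := by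
  by_cases hij : (j : ℕ) ≤ i + 1
  · exact AddSubgroup.subset_closure ⟨linearVertex K t v * a, b * linearVertex K t u, _,
      ⟨hs, isDegreeLeOneRelation_of_le hc hij⟩, by simp only [mul_assoc]⟩
  · have h : linearVertex K t i * relElem K (LinearQuiver n t) c * linearVertex K t j =
        relElem K (LinearQuiver n t) c := vertexElem_mul_relElem_mul hc
    have h0 : linearVertex K t v * (a * relElem K (LinearQuiver n t) c * b) *
        linearVertex K t u = linearVertex K t v * a * linearVertex K t i *
          relElem K (LinearQuiver n t) c * (linearVertex K t j * b * linearVertex K t u) := by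
      conv_lhs => rw [← h]
      simp only [mul_assoc]
    rw [h0]
    rcases lt_or_ge i v with hi | hi
    · rw [linearVertex_mul_mul_eq_zero a i v hi, zero_mul, zero_mul]
      exact zero_mem _
    · have huj : u < j := by
        rw [Fin.le_def] at hi
        rw [Fin.lt_def]
        omega
      rw [linearVertex_mul_mul_eq_zero b u j huj, mul_zero]
      exact zero_mem _

/-- The part of an ideal generated by relations between vertices at distance at most one is
generated by the relations of degree at most one. -/
lemma corner_mem_twoSidedSubmodule {S : Set (PathAlgebra K (LinearQuiver n t))}
    (hrel : ∀ x ∈ S, IsRelation K (LinearQuiver n t) x) {v u : Fin (n + 1)}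
    (hvu : (u : ℕ) ≤ v + 1) {x : PathAlgebra K (LinearQuiver n t)}
    (hx : x ∈ twoSidedSpan (PathAlgebra K (LinearQuiver n t)) S) :
    linearVertex K t v * x * linearVertex K t u ∈
      twoSidedSubmodule K {s ∈ S | IsDegreeLeOneRelation K s} := by
  refine (AddSubgroup.closure_le (K := (twoSidedSubmodule K
    {s ∈ S | IsDegreeLeOneRelation K s}).toAddSubgroup.comap
      ((AddMonoidHom.mulRight (linearVertex K t u)).comp
        (AddMonoidHom.mulLeft (linearVertex K t v))))).2 ?_ hx
  rintro _ ⟨a, b, s, hs, rfl⟩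
  obtain ⟨c, i, j, hc, rfl⟩ := hrel s hs
  exact linearVertex_mul_relElem_mul_mem hvu hc hs a b

lemma mem_cornerRel_linearVertex {A : Type} [Ring A] [Algebra K A] [Module.Finite K A]
    (φ : PathAlgebra K (LinearQuiver n t) →ₐ[K] A) (hφ : Function.Surjective φ)
    {S : Set (PathAlgebra K (LinearQuiver n t))}
    (hrel : ∀ x ∈ S, IsRelation K (LinearQuiver n t) x)
    (hgen : twoSidedSpan (PathAlgebra K (LinearQuiver n t)) S = {x | φ x = 0})
    (hirr : IsGeomIrreducible K (LinearQuiver n t) φ) {i j : Fin (n + 1)} (hij : i ⋖ j)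
    (θ : A ⊗[K] A) (hθ : compressedAct (φ (linearVertex K t i)) (φ (linearVertex K t j))
      (Algebra.lmul K A) θ = 0) :
    θ ∈ cornerRel (φ (linearVertex K t i)) (φ (linearVertex K t j)) := by
  have he : CompleteOrthogonalIdempotents fun v => φ (linearVertex K t v) :=
    (completeOrthogonalIdempotents_linearVertex (K := K) (t := t)).map
      (φ : PathAlgebra K (LinearQuiver n t) →+* A)
  have ht : ∀ u v : Fin (n + 1), u < v → ∀ a,
      φ (linearVertex K t v) * a * φ (linearVertex K t u) = 0 := by
    intro u v huv a
    obtain ⟨x, rfl⟩ := hφ a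
    rw [← map_mul, ← map_mul, linearVertex_mul_mul_eq_zero x u v huv, map_zero]
  have hX : ∀ (X : Type) [AddCommGroup X] [Module K X] [Module.Finite K X]
      (P : Fin (n + 1) → Module.End K X),
      ∀ F ∈ coeffAlgebra (fun v => φ (linearVertex K t v)) X P,
      ∀ G ∈ coeffAlgebra (fun v => φ (linearVertex K t v)) X P,
        F * G = 0 → F = 0 ∨ G = 0 := by
    intro X _ _ _ P F hF G hG hFG
    exact eq_zero_or_eq_zero_of_isGeomIrreducible (Q := LinearQuiver n t) φ hφ hrel hgen hirr
      X P F hF G hG hFG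
  exact mem_cornerRel_of_compressedAct_eq_zero (e := fun v => φ (linearVertex K t v)) he ht hij
    hX θ hθ

end LinearQuiver

/-- Let `Q = Q(n, t₁, …, tₙ)` be the linear quiver and `A = KQ/I` with
`I` admissible.  If `A` is geometrically irreducible, then every minimal set of relations
generating `I` consists of relations of degree at most one (for the grading with
`deg εᵢ = 0`, `deg α_{ji} = 1`); i.e. `R₂ = ⋯ = Rₙ = ∅`. -/
theorem minimal_relations_have_degree_le_one [IsAlgClosed K]
    (n : ℕ) (hn : 1 ≤ n) (t : Fin n → ℕ) (ht : ∀ i, 1 ≤ t i)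
    (A : Type) [Ring A] [Algebra K A] [Module.Finite K A]
    (φ : PathAlgebra K (LinearQuiver n t) →ₐ[K] A)
    (hadm : IsAdmissiblePresentation K (LinearQuiver n t) φ)
    (S : Set (PathAlgebra K (LinearQuiver n t)))
    (hrel : ∀ x ∈ S, IsRelation K (LinearQuiver n t) x)
    (hgen : twoSidedSpan (PathAlgebra K (LinearQuiver n t)) S = {x | φ x = 0})
    (hminimal : ∀ S' ⊆ S,
      twoSidedSpan (PathAlgebra K (LinearQuiver n t)) S' = {x | φ x = 0} → S' = S)
    (hirr : IsGeomIrreducible K (LinearQuiver n t) φ) :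
    ∀ x ∈ S, IsDegreeLeOneRelation K x := by
  have hE := completeOrthogonalIdempotents_linearVertex (K := K) (t := t)
  have hcore : ∀ i j : Fin (n + 1), i ⋖ j → ∀ θ : TensorProduct K A A,
      compressedAct (φ (linearVertex K t i)) (φ (linearVertex K t j)) (Algebra.lmul K A) θ = 0 →
        θ ∈ cornerRel (φ (linearVertex K t i)) (φ (linearVertex K t j)) :=
    fun i j hij θ hθ => mem_cornerRel_linearVertex φ hadm.1 hrel hgen hirr hij θ hθ
  have hgen' : twoSidedSpan (PathAlgebra K (LinearQuiver n t))
      {s ∈ S | IsDegreeLeOneRelation K s} = {x | φ x = 0} := by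
    refine Set.Subset.antisymm ?_ fun x hx => ?_
    · rw [← hgen]
      exact AddSubgroup.closure_mono fun x ⟨a, b, s, hs, h⟩ => ⟨a, b, s, hs.1, h⟩
    · refine mem_of_map_eq_zero hE hadm.1 hcore
        (fun i j u hij hu x => linearVertex_mul_mul_mem_range_throughMap x i j u hij hu)
        (twoSidedSubmodule K {s ∈ S | IsDegreeLeOneRelation K s})
        (fun x hx => mul_mul_mem_twoSidedSubmodule hx)
        (fun v u hvu x hx => corner_mem_twoSidedSubmodule hrel hvu ?_) hx
      rw [hgen]
      exact hx
  intro x hx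
  rw [← hminimal _ (Set.sep_subset _ _) hgen'] at hx
  exact hx.2

end
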